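/- arXiv:1708.08482 — 4 statements merged into one kernel-verified Lean document; each statement's English description precedes it below -/
import Mathlib

section
/- Lower bound for sets: Let p be an odd prime, 0 < α ≤ 1/2, and 0 < ε ≤ 2^{-161}·p^{-8}·α³. Then there exists n at least an exponential tower of p's of height (1/52)·log₂(α³/ε) (i.e., n ≥ T(⌊(1/52)·log₂(α³/ε)⌋) where T(1) = p, T(k+1) = p^{T(k)}) and a subset A ⊆ 𝔽_p^n of density at least α such that for every nonzero d ∈ 𝔽_p^n, the density of 3-APs with common difference d of A is less than α³ − ε. -/
/-- A tower of `p`'s of height `k`: `T 1 = p`, `T (k+1) = p ^ T k` (with `T 0 = 1`). -/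
def towerP (p : ℕ) : ℕ → ℕ
  | 0 => 1
  | k + 1 => p ^ towerP p k

section aux
open Finset

theorem sum_comp_surj {V W : Type*} [AddCommGroup V] [AddCommGroup W] [Fintype V] [Fintype W]
    (f : V →+ W) (hf : Function.Surjective f) (g : W → ℝ) :
    (Fintype.card W : ℝ) * ∑ v, g (f v) = (Fintype.card V : ℝ) * ∑ w, g w := by
  have h1 : ∀ w : W, ∑ v, g (f v) = ∑ v, g (f v + w) := by
    intro w
    obtain ⟨v0, rfl⟩ := hf w
    rw [← Equiv.sum_comp (Equiv.addRight v0) (fun v => g (f v))]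
    simp
  have h2 : ∑ w : W, ∑ v, g (f v) = ∑ w : W, ∑ v, g (f v + w) :=
    Finset.sum_congr rfl fun w _ => h1 w
  rw [Finset.sum_comm (f := fun w v => g (f v + w))] at h2
  have h3 : ∀ v : V, ∑ w : W, g (f v + w) = ∑ w, g w := fun v =>
    Equiv.sum_comp (Equiv.addLeft (f v)) g
  simp only [h3, Finset.sum_const, Finset.card_univ, nsmul_eq_mul] at h2
  exact h2

def wE {ι K : Type*} [Fintype ι] [DecidableEq ι] [Fintype K] (w : ι → K → ℝ) (G : (ι → K) → ℝ) : ℝ :=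
  ∑ ω, (∏ i, w i (ω i)) * G ω

theorem wE_one {ι K : Type*} [Fintype ι] [DecidableEq ι] [Fintype K] (w : ι → K → ℝ)
    (h1 : ∀ i, ∑ k, w i k = 1) : ∑ ω : ι → K, (∏ i, w i (ω i)) = 1 := by
  have := Finset.prod_univ_sum (fun _ : ι => (Finset.univ : Finset K)) (fun i k => w i k)
  rw [Fintype.piFinset_univ] at this
  rw [← this]; simp [h1]

theorem wE_succ {N : ℕ} {K : Type*} [Fintype K] (w : Fin (N+1) → K → ℝ) (G : (Fin (N+1) → K) → ℝ) :
    wE w G = wE (fun i => w i.succ) (fun ω => ∑ k, w 0 k * G (Fin.cons k ω)) := by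
  unfold wE
  rw [← (Fin.consEquiv (fun _ => K)).sum_comp, Fintype.sum_prod_type, Finset.sum_comm]
  refine Finset.sum_congr rfl fun ω _ => ?_
  rw [Finset.mul_sum]
  refine Finset.sum_congr rfl fun k _ => ?_
  simp [Fin.consEquiv, Fin.prod_univ_succ]
  ring

theorem exp_quad {x : ℝ} (hx : |x| ≤ 1) : Real.exp x ≤ 1 + x + x^2 := by
  have := Real.abs_exp_sub_one_sub_id_le hx
  have := (abs_le.1 this).2
  linarith

theorem mcd {K : Type*} [Fintype K] (l : ℝ) : ∀ (N : ℕ) (w : Fin N → K → ℝ)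
    (_ : ∀ i k, 0 ≤ w i k) (_ : ∀ i, ∑ k, w i k = 1) (c : Fin N → ℝ) (G : (Fin N → K) → ℝ)
    (_ : ∀ ω i k, |G (Function.update ω i k) - G ω| ≤ c i) (_ : ∀ i, |l| * c i ≤ 1),
    wE w (fun ω => Real.exp (l * (G ω - wE w G))) ≤ Real.exp (l^2 * ∑ i, c i ^ 2) := by
  intro N
  induction N with
  | zero =>
    intro w _ _ c G _ _
    simp [wE]
  | succ N ih =>
    intro w hw h1 c G hG hl
    set w' : Fin N → K → ℝ := fun i => w i.succ
    set G' : (Fin N → K) → ℝ := fun ω => ∑ k, w 0 k * G (Fin.cons k ω) with hG'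
    have e1 : wE w G = wE w' G' := wE_succ w G
    rw [e1, wE_succ]
    have key : ∀ ω : Fin N → K, ∑ k, w 0 k * Real.exp (l * (G (Fin.cons k ω) - wE w' G')) ≤
        Real.exp (l^2 * c 0 ^2) * Real.exp (l * (G' ω - wE w' G')) := by
      intro ω
      have hd : ∀ k k', |G (Fin.cons k ω) - G (Fin.cons k' ω)| ≤ c 0 := by
        intro k k'
        have := hG (Fin.cons k' ω) 0 k
        rwa [Fin.update_cons_zero] at this
      have hd' : ∀ k, |G (Fin.cons k ω) - G' ω| ≤ c 0 := by
        intro k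
        have : G (Fin.cons k ω) - G' ω = ∑ k', w 0 k' * (G (Fin.cons k ω) - G (Fin.cons k' ω)) := by
          simp only [mul_sub, Finset.sum_sub_distrib, ← Finset.sum_mul, h1, one_mul, hG']
        rw [this]
        calc _ ≤ ∑ k', |w 0 k' * (G (Fin.cons k ω) - G (Fin.cons k' ω))| := Finset.abs_sum_le_sum_abs _ _
          _ ≤ ∑ k', w 0 k' * c 0 := by
            refine Finset.sum_le_sum fun k' _ => ?_
            rw [abs_mul, abs_of_nonneg (hw _ _)]
            exact mul_le_mul_of_nonneg_left (hd _ _) (hw _ _)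
          _ = c 0 := by rw [← Finset.sum_mul, h1, one_mul]
      have hb : ∀ k, Real.exp (l * (G (Fin.cons k ω) - G' ω)) ≤
          1 + l * (G (Fin.cons k ω) - G' ω) + l^2 * c 0^2 := by
        intro k
        have h2 : |l * (G (Fin.cons k ω) - G' ω)| ≤ 1 := by
          rw [abs_mul]
          exact (mul_le_mul_of_nonneg_left (hd' k) (abs_nonneg _)).trans (hl 0)
        have h3 := exp_quad h2
        have h4 : (l * (G (Fin.cons k ω) - G' ω))^2 ≤ l^2 * c 0^2 := by
          rw [mul_pow]
          apply mul_le_mul_of_nonneg_left _ (sq_nonneg l)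
          rw [← sq_abs]
          exact pow_le_pow_left₀ (abs_nonneg _) (hd' k) 2
        linarith
      have hs : ∑ k, w 0 k * Real.exp (l * (G (Fin.cons k ω) - G' ω)) ≤ Real.exp (l^2 * c 0^2) := by
        calc _ ≤ ∑ k, w 0 k * (1 + l * (G (Fin.cons k ω) - G' ω) + l^2 * c 0^2) :=
              Finset.sum_le_sum fun k _ => mul_le_mul_of_nonneg_left (hb k) (hw _ _)
          _ = (1 + l^2 * c 0^2) * ∑ k, w 0 k + l * ((∑ k, w 0 k * G (Fin.cons k ω)) - (∑ k, w 0 k) * G' ω) := by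
              rw [Finset.sum_mul, ← Finset.sum_sub_distrib, Finset.mul_sum, Finset.mul_sum, ← Finset.sum_add_distrib]
              refine Finset.sum_congr rfl fun k _ => ?_
              ring
          _ = l^2 * c 0^2 + 1 := by rw [h1]; simp only [hG']; ring
          _ ≤ _ := Real.add_one_le_exp _
      calc _ = ∑ k, (w 0 k * Real.exp (l * (G (Fin.cons k ω) - G' ω))) * Real.exp (l * (G' ω - wE w' G')) := by
            refine Finset.sum_congr rfl fun k _ => ?_
            rw [mul_assoc, ← Real.exp_add]; congr 2; ring
        _ ≤ _ := by
            rw [← Finset.sum_mul]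
            exact mul_le_mul_of_nonneg_right hs (Real.exp_pos _).le
    have hi := ih w' (fun i k => hw _ _) (fun i => h1 _) (fun i => c i.succ) G' (by
      intro ω i k
      simp only [hG', ← Finset.sum_sub_distrib, ← mul_sub]
      calc _ ≤ ∑ k', |w 0 k' * (G (Fin.cons k' (Function.update ω i k)) - G (Fin.cons k' ω))| := Finset.abs_sum_le_sum_abs _ _
          _ ≤ ∑ k', w 0 k' * c i.succ := by
            refine Finset.sum_le_sum fun k' _ => ?_
            rw [abs_mul, abs_of_nonneg (hw _ _)]
            refine mul_le_mul_of_nonneg_left ?_ (hw _ _)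
            rw [Fin.cons_update]
            exact hG _ _ _
          _ = c i.succ := by rw [← Finset.sum_mul, h1, one_mul]) (fun i => hl _)
    calc _ ≤ wE w' (fun ω => Real.exp (l^2 * c 0 ^2) * Real.exp (l * (G' ω - wE w' G'))) := by
          unfold wE
          exact Finset.sum_le_sum fun ω _ => mul_le_mul_of_nonneg_left (key ω) (Finset.prod_nonneg fun i _ => hw _ _)
      _ = Real.exp (l^2 * c 0 ^2) * wE w' (fun ω => Real.exp (l * (G' ω - wE w' G'))) := by
          unfold wE
          rw [Finset.mul_sum]
          refine Finset.sum_congr rfl fun k _ => ?_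
          ring
      _ ≤ Real.exp (l^2 * c 0 ^2) * Real.exp (l^2 * ∑ i : Fin N, c i.succ ^ 2) :=
          mul_le_mul_of_nonneg_left hi (Real.exp_pos _).le
      _ = _ := by rw [← Real.exp_add, Fin.sum_univ_succ]; congr 1; ring

theorem wE_reindex {ι κ K : Type*} [Fintype ι] [DecidableEq ι] [Fintype κ] [DecidableEq κ] [Fintype K]
    (e : κ ≃ ι) (w : ι → K → ℝ) (G : (ι → K) → ℝ) :
    wE w G = wE (fun i => w (e i)) (fun ω => G (fun i => ω (e.symm i))) := by
  unfold wE
  rw [← (Equiv.arrowCongr e (Equiv.refl K)).sum_comp]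
  refine Finset.sum_congr rfl fun ω _ => ?_
  congr 1
  rw [← e.prod_comp]
  simp

theorem tail {ι K : Type*} [Fintype ι] [DecidableEq ι] [Fintype K] (w : ι → K → ℝ)
    (hw : ∀ i k, 0 ≤ w i k) (h1 : ∀ i, ∑ k, w i k = 1) (c : ι → ℝ) (G : (ι → K) → ℝ)
    (hG : ∀ ω i k, |G (Function.update ω i k) - G ω| ≤ c i) (l t : ℝ) (hl0 : 0 ≤ l)
    (hl : ∀ i, l * c i ≤ 1) (B : Finset (ι → K)) (hB : ∀ ω ∈ B, wE w G + t ≤ G ω) :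
    ∑ ω ∈ B, ∏ i, w i (ω i) ≤ Real.exp (l^2 * ∑ i, c i ^ 2 - l * t) := by
  have m : wE w (fun ω => Real.exp (l * (G ω - wE w G))) ≤ Real.exp (l^2 * ∑ i, c i ^ 2) := by
    let e := (Fintype.equivFin ι).symm
    rw [wE_reindex e w G, wE_reindex e w]
    have := mcd l _ (fun i => w (e i)) (fun i k => hw _ _) (fun i => h1 _) (fun i => c (e i))
      (fun ω => G (fun i => ω (e.symm i))) (by
        intro ω i k
        have := hG (fun i => ω (e.symm i)) (e i) k
        convert this using 4
        ext j
        simp only [Function.update_apply, Equiv.symm_apply_eq]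
        ) (fun i => by rw [abs_of_nonneg hl0]; exact hl _)
    rw [← e.sum_comp (fun i => c i ^2)]
    exact this
  have hp : ∀ ω : ι → K, 0 ≤ ∏ i, w i (ω i) := fun ω => Finset.prod_nonneg fun i _ => hw _ _
  have : (∑ ω ∈ B, ∏ i, w i (ω i)) * Real.exp (l * t) ≤ Real.exp (l^2 * ∑ i, c i ^ 2) := by
    refine le_trans ?_ m
    rw [Finset.sum_mul]
    rw [show ∀ g, wE w g = ∑ ω, (∏ i, w i (ω i)) * g ω from fun g => rfl]
    refine le_trans ?_ (Finset.sum_le_sum_of_subset_of_nonneg (Finset.subset_univ B)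
      (fun ω _ _ => mul_nonneg (hp ω) (Real.exp_pos _).le))
    refine Finset.sum_le_sum fun ω hω => mul_le_mul_of_nonneg_left ?_ (hp ω)
    apply Real.exp_le_exp.2
    apply mul_le_mul_of_nonneg_left _ hl0
    linarith [hB ω hω]
  rw [Real.exp_sub, le_div_iff₀ (Real.exp_pos _)]
  exact this

theorem par_count (L : ℕ) : (L:ℝ)^2 / 2 ≤ ∑ u ∈ range L, ∑ w ∈ range L, (if (u + w) % 2 = 0 then (1:ℝ) else 0) := by
  have h : ∀ u w : ℕ, (if (u + w) % 2 = 0 then (1:ℝ) else 0) = 1/2 + (-1:ℝ)^u * (-1)^w / 2 := by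
    intro u w
    rw [← pow_add]
    rcases Nat.even_or_odd (u+w) with h | h
    · rw [h.neg_one_pow, if_pos (Nat.even_iff.1 h)]; norm_num
    · rw [h.neg_one_pow, if_neg (by rw [Nat.odd_iff.1 h]; norm_num)]; norm_num
  simp only [h]
  have : ∑ u ∈ range L, ∑ w ∈ range L, ((1:ℝ)/2 + (-1:ℝ)^u * (-1)^w / 2) =
      (L:ℝ)^2/2 + (∑ u ∈ range L, (-1:ℝ)^u)^2/2 := by
    rw [sq (∑ u ∈ range L, (-1:ℝ)^u), Finset.sum_mul_sum, Finset.sum_div]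
    simp only [Finset.sum_add_distrib, Finset.sum_div]
    simp; ring
  rw [this]
  nlinarith [sq_nonneg (∑ u ∈ range L, (-1:ℝ)^u)]

theorem exists_h (p : ℕ) [Fact p.Prime] (hodd : Odd p) : ∃ h : ZMod p → ℝ,
    (∀ x, 0 ≤ h x) ∧ (∀ x, h x ≤ 3/2) ∧ ∑ x, h x = p ∧
    ∑ t, ∑ s, h s * h (s+t) * h (s+2*t) ≤ (63/64) * (p:ℝ)^2 := by
  have hp : p.Prime := Fact.out
  have hp3 : 3 ≤ p := by
    have := hp.two_le
    rcases hodd with ⟨k, hk⟩; omega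
  set L := p / 3 with hL
  have hL1 : 3 * L ≤ p := by omega
  have hL2 : p ≤ 5 * L := by
    by_cases h5 : p = 3
    · omega
    · have : p ≠ 4 := by rintro h; rw [h] at hodd; revert hodd; decide
      omega
  have h2 : (2 : ZMod p) ≠ 0 := by
    have : ((2:ℕ) : ZMod p) ≠ 0 := by
      rw [Ne, ZMod.natCast_eq_zero_iff]
      intro h; have := Nat.le_of_dvd (by norm_num) h; omega
    exact_mod_cast this
  let b : ZMod p → ℝ := fun x => if x.val < L then 1 else 0
  have hb0 : ∀ x, 0 ≤ b x := fun x => by simp only [b]; split_ifs <;> norm_num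
  have hb1 : ∀ x, b x ≤ 1 := fun x => by simp only [b]; split_ifs <;> norm_num
  have hsum : ∀ g : ZMod p → ℝ, ∑ x, b x * g x = ∑ u ∈ range L, g (u : ZMod p) := by
    intro g
    simp only [b, ite_mul, one_mul, zero_mul]
    rw [← Finset.sum_filter]
    symm
    refine Finset.sum_bij (fun u _ => (u : ZMod p)) ?_ ?_ ?_ ?_
    · intro u hu
      rw [Finset.mem_range] at hu
      simp only [mem_filter, mem_univ, true_and]
      rw [ZMod.val_natCast_of_lt (by omega)]; exact hu
    · intro u hu v hv h
      rw [Finset.mem_range] at hu hv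
      have := congrArg ZMod.val h
      rwa [ZMod.val_natCast_of_lt (by omega), ZMod.val_natCast_of_lt (by omega)] at this
    · intro x hx
      refine ⟨x.val, by simpa using hx, by simp⟩
    · intro u hu; rfl
  have hbs : ∑ x, b x = L := by
    have := hsum (fun _ => 1); simpa using this
  have hcard : (Fintype.card (ZMod p) : ℝ) = p := by rw [ZMod.card]
  have q1 : ∑ t, ∑ s, b s * b (s+t) = (L:ℝ)^2 := by
    rw [Finset.sum_comm]
    simp only [← Finset.mul_sum]
    have : ∀ s, ∑ t, b (s+t) = L := fun s => (Equiv.sum_comp (Equiv.addLeft s) b).trans hbs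
    simp only [this, ← Finset.sum_mul, hbs]; ring
  have hdouble : ∀ g : ZMod p → ℝ, ∑ t, g (2*t) = ∑ t, g t := fun g =>
    Equiv.sum_comp (Equiv.mulLeft₀ (2:ZMod p) h2) g
  have q2 : ∑ t, ∑ s, b s * b (s+2*t) = (L:ℝ)^2 := by
    rw [hdouble (fun t => ∑ s, b s * b (s+t)), q1]
  have q3 : ∑ t, ∑ s, b (s+t) * b (s+2*t) = (L:ℝ)^2 := by
    rw [← q1]
    refine Finset.sum_congr rfl fun t _ => ?_
    rw [← Equiv.sum_comp (Equiv.addRight t) (fun s => b s * b (s+t))]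
    refine Finset.sum_congr rfl fun s _ => ?_
    simp only [Equiv.coe_addRight]
    congr 2; ring
  have l1 : ∑ t : ZMod p, ∑ s, b s = (p:ℝ)*L := by simp [hbs]
  have l2 : ∑ t : ZMod p, ∑ s, b (s+t) = (p:ℝ)*L := by
    have : ∀ t, ∑ s, b (s+t) = L := fun s => (Equiv.sum_comp (Equiv.addRight s) b).trans hbs
    simp [this]
  have l3 : ∑ t : ZMod p, ∑ s, b (s+2*t) = (p:ℝ)*L := by
    rw [hdouble (fun t => ∑ s, b (s+t)), l2]
  have T : (L:ℝ)^2/2 ≤ ∑ t, ∑ s, b s * b (s+t) * b (s+2*t) := by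
    have : ∑ t, ∑ s, b s * b (s+t) * b (s+2*t) = ∑ u, b u * ∑ w, b w * b ((u+w)/2) := by
      rw [Finset.sum_comm]
      refine Finset.sum_congr rfl fun s _ => ?_
      rw [Finset.mul_sum]
      have := hdouble (fun t => b s * b (s+t/2) * b (s+t))
      have e : ∀ t : ZMod p, 2*t/2 = t := fun t => by field_simp
      simp only [e] at this
      rw [this, ← Equiv.sum_comp (Equiv.addLeft s) (fun w => b s * (b w * b ((s+w)/2)))]
      refine Finset.sum_congr rfl fun t _ => ?_
      simp only [Equiv.coe_addLeft]
      have : (s + (s+t))/2 = s + t/2 := by field_simp; ring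
      rw [this]; ring
    rw [this, hsum]
    simp only [hsum]
    refine (par_count L).trans (Finset.sum_le_sum fun u hu => Finset.sum_le_sum fun w hw => ?_)
    split_ifs with h
    · rw [Finset.mem_range] at hu hw
      obtain ⟨m, hm⟩ : ∃ m, u + w = 2*m := ⟨(u+w)/2, by omega⟩
      have : ((u:ZMod p) + w)/2 = (m : ℕ) := by
        rw [div_eq_iff h2]
        have : ((u+w:ℕ) : ZMod p) = ((2*m : ℕ) : ZMod p) := by rw [hm]
        push_cast at this; rw [this]; ring
      rw [this]
      simp only [b]
      rw [if_pos]
      rw [ZMod.val_natCast_of_lt (by omega)]; omega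
    · exact hb0 _
  have hpR : (0:ℝ) < p := by exact_mod_cast hp.pos
  have hL1R : 3 * (L:ℝ) ≤ p := by exact_mod_cast hL1
  have hL2R : (p:ℝ) ≤ 5 * L := by exact_mod_cast hL2
  have hpos : (0:ℝ) < p - L := by linarith
  set k : ℝ := p / (p - L) with hk
  have hk0 : 0 < k := div_pos hpR hpos
  have hk1 : k ≤ 3/2 := by rw [hk, div_le_iff₀ hpos]; linarith
  refine ⟨fun x => k * (1 - b x), fun x => mul_nonneg hk0.le (by linarith [hb1 x]),
    fun x => by nlinarith [hb0 x, hb1 x], ?_, ?_⟩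
  · rw [← Finset.mul_sum, Finset.sum_sub_distrib, hbs]
    simp [hk]; field_simp
  · have : ∑ t, ∑ s, k * (1 - b s) * (k * (1 - b (s+t))) * (k * (1 - b (s+2*t))) =
        k^3 * ((p:ℝ)^2 - 3 * p * L + 3 * L^2 - ∑ t, ∑ s, b s * b (s+t) * b (s+2*t)) := by
      have c1 : ∑ t : ZMod p, ∑ s : ZMod p, (1:ℝ) = (p:ℝ)^2 := by simp; ring
      have : (p:ℝ)^2 - 3 * p * L + 3 * L^2 - ∑ t, ∑ s, b s * b (s+t) * b (s+2*t) =
        ∑ t : ZMod p, ∑ s : ZMod p, (1:ℝ) - ∑ t : ZMod p, ∑ s, b s - ∑ t : ZMod p, ∑ s, b (s+t)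
          - ∑ t : ZMod p, ∑ s, b (s+2*t) + ∑ t, ∑ s, b s * b (s+t) + ∑ t, ∑ s, b s * b (s+2*t)
          + ∑ t, ∑ s, b (s+t) * b (s+2*t) - ∑ t, ∑ s, b s * b (s+t) * b (s+2*t) := by
        rw [c1, l1, l2, l3, q1, q2, q3]; ring
      rw [this]
      simp only [← Finset.sum_sub_distrib, ← Finset.sum_add_distrib, Finset.mul_sum]
      refine Finset.sum_congr rfl fun t _ => Finset.sum_congr rfl fun s _ => ?_
      ring
    rw [this]
    calc _ ≤ k^3 * ((p:ℝ)^2 - 3 * p * L + 5/2 * L^2) := by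
          apply mul_le_mul_of_nonneg_left _ (by positivity); linarith
      _ ≤ _ := by
          rw [hk, div_pow, div_mul_eq_mul_div, div_le_iff₀ (by positivity)]
          have : (p:ℝ) * ((p:ℝ)^2 - 3 * p * L + 5/2 * L^2) ≤ 63/64 * (p-L)^3 := by
            nlinarith [mul_nonneg (sub_nonneg.2 hL1R) (sub_nonneg.2 hL2R), mul_nonneg (mul_nonneg (sub_nonneg.2 hL1R) (sub_nonneg.2 hL2R)) hpR.le, mul_nonneg (mul_nonneg (sub_nonneg.2 hL1R) (sub_nonneg.2 hL2R)) (sub_nonneg.2 hL1R), mul_nonneg (mul_nonneg (sub_nonneg.2 hL1R) (sub_nonneg.2 hL2R)) (sub_nonneg.2 hL2R), pow_pos hpR 3, mul_nonneg (sub_nonneg.2 hL2R) (sq_nonneg (p:ℝ)), pow_nonneg (sub_nonneg.2 hL2R) 3, pow_nonneg (sub_nonneg.2 hL1R) 3]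
          nlinarith [mul_le_mul_of_nonneg_left this (sq_nonneg (p:ℝ))]

theorem union_exists {Ω J : Type*} [Fintype Ω] [Fintype J] (μ : Ω → ℝ) (h0 : ∀ ω, 0 ≤ μ ω)
    (h1 : ∑ ω, μ ω = 1) (Bad : J → Ω → Prop) [∀ j, DecidablePred (Bad j)] (β : J → ℝ)
    (hb : ∀ j, ∑ ω with Bad j ω, μ ω ≤ β j) (hβ : ∑ j, β j < 1) : ∃ ω, ∀ j, ¬ Bad j ω := by
  by_contra hcon
  push Not at hcon
  have : (1:ℝ) ≤ ∑ j, β j := by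
    rw [← h1]
    calc ∑ ω, μ ω ≤ ∑ ω, ∑ j, (if Bad j ω then μ ω else 0) := by
          refine Finset.sum_le_sum fun ω _ => ?_
          obtain ⟨j, hj⟩ := hcon ω
          have := Finset.single_le_sum (f := fun j => if Bad j ω then μ ω else 0)
            (fun i _ => by split_ifs; exacts [h0 ω, le_rfl]) (Finset.mem_univ j)
          simpa [hj] using this
      _ = ∑ j, ∑ ω with Bad j ω, μ ω := by
          rw [Finset.sum_comm]
          simp only [Finset.sum_filter]
      _ ≤ _ := Finset.sum_le_sum fun j _ => hb j
  linarith

theorem dot_surj {p m : ℕ} [Fact p.Prime] (d : Fin m → ZMod p) (hd : d ≠ 0) (x : ZMod p) :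
    ∃ v : Fin m → ZMod p, v ⬝ᵥ d = x := by
  obtain ⟨i, hi⟩ := Function.ne_iff.1 hd
  simp only [Pi.zero_apply] at hi
  refine ⟨Pi.single i (x / d i), ?_⟩
  rw [single_dotProduct]; field_simp

theorem exists_code (p : ℕ) [Fact p.Prime] {Y : Type*} [Fintype Y] [DecidableEq Y] (m : ℕ)
    (lam : ZMod p → ℝ) (h0 : ∀ t, 0 ≤ lam t) (h1 : ∀ t, lam t ≤ 9/4)
    (hs : ∑ t, lam t ≤ 63/64 * p) (P : Finset Y)
    (hP : 2^19 * (m * Real.log p + 1) ≤ (P.card : ℝ))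
    (hY : 2 * ((Fintype.card Y : ℝ) * p)^3 ≤ (p:ℝ)^m) :
    ∃ v : Y → (Fin m → ZMod p),
      (∀ f : Fin 3 → Y, Function.Injective f → ∀ a : Fin 3 → ZMod p, ∑ i, a i • v (f i) = 0 → a = 0) ∧
      ∀ d : Fin m → ZMod p, d ≠ 0 → ∑ y ∈ P, lam (v y ⬝ᵥ d) ≤ 127/128 * P.card := by
  classical
  have hp : p.Prime := Fact.out
  have hp0 : (0:ℝ) < p := by exact_mod_cast hp.pos
  set V := Fin m → ZMod p with hV
  have hcV : (Fintype.card V : ℝ) = (p:ℝ)^m := by simp [hV, ZMod.card]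
  have hV0 : (0:ℝ) < Fintype.card V := by rw [hcV]; positivity
  have hcO : (Fintype.card (Y → V) : ℝ) = (Fintype.card V : ℝ)^(Fintype.card Y) := by
    rw [Fintype.card_fun]; push_cast; rfl
  have hO0 : (0:ℝ) < Fintype.card (Y → V) := by rw [hcO]; positivity
  let w : Y → V → ℝ := fun _ _ => 1 / Fintype.card V
  have hwp : ∀ ω : Y → V, ∏ i, w i (ω i) = 1 / Fintype.card (Y → V) := by
    intro ω; simp only [w, Finset.prod_const, Finset.card_univ, hcO]; rw [div_pow, one_pow]
  have hw0 : ∀ i k, 0 ≤ w i k := fun i k => by simp only [w]; positivity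
  have hw1 : ∀ i, ∑ k, w i k = 1 := fun i => by
    simp only [w, Finset.sum_const, Finset.card_univ, nsmul_eq_mul]; field_simp
  let Bad : ((Fin 3 → Y) × (Fin 3 → ZMod p)) ⊕ V → (Y → V) → Prop := fun j ω =>
    match j with
    | Sum.inl (f, a) => Function.Injective f ∧ a ≠ 0 ∧ ∑ i, a i • ω (f i) = 0
    | Sum.inr d => d ≠ 0 ∧ 127/128 * (P.card:ℝ) < ∑ y ∈ P, lam (ω y ⬝ᵥ d)
  have := union_exists (Ω := Y → V) (fun ω => ∏ i, w i (ω i))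
    (fun ω => Finset.prod_nonneg fun i _ => hw0 i (ω i)) (wE_one w hw1) Bad
    (Sum.elim (fun _ => 1 / (p:ℝ)^m) (fun _ => Real.exp (-(m * Real.log p + 1)))) ?_ ?_
  · obtain ⟨v, hv⟩ := this
    refine ⟨v, fun f hf a ha => ?_, fun d hd => ?_⟩
    · by_contra h
      exact hv (Sum.inl (f, a)) ⟨hf, h, ha⟩
    · by_contra h
      exact hv (Sum.inr d) ⟨hd, not_le.1 h⟩
  · rintro (⟨f, a⟩ | d)
    · simp only [Sum.elim_inl, Bad, hwp]
      by_cases hf : Function.Injective f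
      swap
      · simp only [hf, false_and, Finset.filter_false, Finset.sum_empty]; positivity
      by_cases ha : a = 0
      · simp only [ha, ne_eq, not_true, false_and, and_false, Finset.filter_false, Finset.sum_empty]; positivity
      let φ : (Y → V) →+ V :=
        { toFun := fun ω => ∑ i, a i • ω (f i)
          map_zero' := by simp
          map_add' := fun x y => by simp [smul_add, Finset.sum_add_distrib] }
      have hφ : Function.Surjective φ := by
        intro x
        obtain ⟨i, hi⟩ := Function.ne_iff.1 ha
        simp only [Pi.zero_apply] at hi
        refine ⟨Pi.single (f i) ((a i)⁻¹ • x), ?_⟩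
        change ∑ j, a j • (Pi.single (f i) ((a i)⁻¹ • x) : Y → V) (f j) = x
        rw [Finset.sum_eq_single i]
        · rw [Pi.single_eq_same, smul_smul, mul_inv_cancel₀ hi, one_smul]
        · intro j _ hj
          rw [Pi.single_eq_of_ne (fun h => hj (hf h)), smul_zero]
        · simp
      have := sum_comp_surj φ hφ (fun x => if x = 0 then 1 else 0)
      rw [Finset.sum_ite_eq' , if_pos (Finset.mem_univ _), mul_one] at this
      have e : ∑ ω : Y → V with Function.Injective f ∧ a ≠ 0 ∧ ∑ i, a i • ω (f i) = 0, 1 / (Fintype.card (Y → V):ℝ) =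
          (∑ ω : Y → V, if φ ω = 0 then (1:ℝ) else 0) / Fintype.card (Y → V) := by
        rw [Finset.sum_div, Finset.sum_filter]
        refine Finset.sum_congr rfl fun ω _ => ?_
        have : φ ω = ∑ i, a i • ω (f i) := rfl
        simp only [hf, ha, this, ne_eq, not_false_iff, true_and]
        split_ifs <;> simp
      rw [e, div_le_div_iff₀ hO0 (by positivity), ← hcV, one_mul, mul_comm]
      exact this.le
    · simp only [Sum.elim_inr, Bad]
      by_cases hd : d = 0
      · simp only [hd, ne_eq, not_true, false_and, Finset.filter_false, Finset.sum_empty]; positivity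
      set G : (Y → V) → ℝ := fun ω => ∑ y ∈ P, lam (ω y ⬝ᵥ d) with hG
      have hmean : wE w G ≤ 63/64 * P.card := by
        have e1 : wE w G = ∑ y ∈ P, (∑ ω : Y → V, lam (ω y ⬝ᵥ d)) / Fintype.card (Y → V) := by
          unfold wE
          simp only [hwp, hG, Finset.mul_sum, Finset.sum_div]
          rw [Finset.sum_comm]
          refine Finset.sum_congr rfl fun y _ => Finset.sum_congr rfl fun ω _ => ?_
          ring
        have e2 : ∀ y, (∑ ω : Y → V, lam (ω y ⬝ᵥ d)) / Fintype.card (Y → V) ≤ 63/64 := by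
          intro y
          let φ : (Y → V) →+ ZMod p :=
            { toFun := fun ω => ω y ⬝ᵥ d
              map_zero' := by simp
              map_add' := fun x x' => add_dotProduct (x y) (x' y) d }
          have hφ : Function.Surjective φ := by
            intro x
            obtain ⟨v, hv⟩ := dot_surj d hd x
            exact ⟨fun _ => v, hv⟩
          have := sum_comp_surj φ hφ lam
          rw [ZMod.card] at this
          have t2 : (p:ℝ) * ∑ ω : Y → V, lam (ω y ⬝ᵥ d) ≤ p * (63/64 * Fintype.card (Y → V)) := by
            refine this.le.trans ?_
            nlinarith [mul_le_mul_of_nonneg_left hs hO0.le]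
          rw [div_le_iff₀ hO0]
          exact le_of_mul_le_mul_left t2 hp0
        rw [e1]
        refine (Finset.sum_le_sum fun y _ => e2 y).trans ?_
        simp; linarith
      have := tail w hw0 hw1 (fun y => if y ∈ P then 9/4 else 0) G (by
          intro ω i k
          have : G (Function.update ω i k) - G ω = if i ∈ P then lam (k ⬝ᵥ d) - lam (ω i ⬝ᵥ d) else 0 := by
            simp only [hG, ← Finset.sum_sub_distrib]
            rw [← Finset.sum_ite_eq' P i (fun _ => lam (k ⬝ᵥ d) - lam (ω i ⬝ᵥ d))]
            refine Finset.sum_congr rfl fun y _ => ?_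
            split_ifs with h
            · subst h; simp
            · simp [Function.update_of_ne h]
          rw [this]
          split_ifs
          · rw [abs_le]; constructor <;> linarith [h0 (k ⬝ᵥ d), h1 (k ⬝ᵥ d), h0 (ω i ⬝ᵥ d), h1 (ω i ⬝ᵥ d)]
          · simp)
        (1/1296) (P.card/128) (by norm_num) (fun i => by split_ifs <;> norm_num)
        (Finset.univ.filter fun ω : Y → V => d ≠ 0 ∧ 127/128 * (P.card:ℝ) < ∑ y ∈ P, lam (ω y ⬝ᵥ d)) (by
          intro ω hω
          simp only [Finset.mem_filter, Finset.mem_univ, true_and] at hω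
          have := hω.2
          simp only [hG] at hmean ⊢
          linarith)
      refine this.trans (Real.exp_le_exp.2 ?_)
      have e3 : ∑ i : Y, (if i ∈ P then (9/4:ℝ) else 0)^2 = 81/16 * P.card := by
        simp only [ite_pow, ne_eq, OfNat.ofNat_ne_zero, not_false_eq_true, zero_pow]
        rw [Finset.sum_ite_mem]; simp; ring
      rw [e3]
      nlinarith
  · rw [Fintype.sum_sum_type]
    simp only [Sum.elim_inl, Sum.elim_inr, Finset.sum_const, Finset.card_univ, nsmul_eq_mul, hcV]
    have a1 : ((Fintype.card ((Fin 3 → Y) × (Fin 3 → ZMod p)) : ℕ) : ℝ) = ((Fintype.card Y : ℝ) * p)^3 := by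
      rw [Fintype.card_prod, Fintype.card_fun, Fintype.card_fun, ZMod.card]; push_cast; simp; ring
    have a2 : (p:ℝ)^m * Real.exp (-(m * Real.log p + 1)) = Real.exp (-1) := by
      have : (p:ℝ)^m = Real.exp (m * Real.log p) := by
        rw [Real.exp_nat_mul, Real.exp_log hp0]
      rw [this, ← Real.exp_add]; congr 1; ring
    have a3 : Real.exp (-1) < 1/2 := by
      have := Real.exp_neg_one_lt_d9
      linarith
    rw [a1, a2]
    have : ((Fintype.card Y : ℝ) * p)^3 * (1/(p:ℝ)^m) ≤ 1/2 := by
      rw [mul_one_div, div_le_iff₀ (by positivity)]; linarith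
    linarith

def Lam {X : Type*} [AddCommGroup X] [Fintype X] (F : X → ℝ) (d : X) : ℝ :=
  ∑ x, F x * F (x + d) * F (x + 2 • d)

structure Good {X : Type*} [AddCommGroup X] [Fintype X] (F : X → ℝ) (κ σ δ : ℝ) : Prop where
  nonneg : ∀ x, 0 ≤ F x
  le : ∀ x, F x ≤ 5/3
  sum : ∑ x, F x = Fintype.card X
  lam : ∀ d, d ≠ 0 → Lam F d ≤ (1 - δ) * Fintype.card X
  cube : ∑ x, F x ^ 3 ≤ (1 + σ) * Fintype.card X
  unp : ∃ U : Finset X, (∀ x ∈ U, F x = κ) ∧ (1 - σ) * Fintype.card X ≤ U.card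

theorem Good.transfer {X X' : Type*} [AddCommGroup X] [Fintype X] [AddCommGroup X'] [Fintype X']
    {F : X → ℝ} {κ σ δ : ℝ} (hF : Good F κ σ δ) (e : X' ≃+ X) : Good (fun x => F (e x)) κ σ δ := by
  have hc : Fintype.card X' = Fintype.card X := Fintype.card_congr e.toEquiv
  refine ⟨fun x => hF.nonneg _, fun x => hF.le _, ?_, ?_, ?_, ?_⟩
  · rw [hc, ← hF.sum]; exact Equiv.sum_comp e.toEquiv F
  · intro d hd
    rw [hc]
    refine le_trans (le_of_eq ?_) (hF.lam (e d) (by simpa using hd))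
    unfold Lam
    rw [← Equiv.sum_comp e.toEquiv]
    simp
  · rw [hc]
    refine le_trans (le_of_eq ?_) hF.cube
    exact Equiv.sum_comp e.toEquiv (fun x => F x ^ 3)
  · obtain ⟨U, h1, h2⟩ := hF.unp
    refine ⟨U.map e.symm.toEquiv.toEmbedding, ?_, ?_⟩
    · intro x hx
      simp only [Finset.mem_map] at hx
      obtain ⟨a, ha, rfl⟩ := hx
      simpa using h1 a ha
    · rw [hc, Finset.card_map]; exact h2

theorem triple_surj {p m : ℕ} [Fact p.Prime] (v : Fin 3 → (Fin m → ZMod p))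
    (hv : ∀ a : Fin 3 → ZMod p, ∑ i, a i • v i = 0 → a = 0) (t : Fin 3 → ZMod p) :
    ∃ z : Fin m → ZMod p, ∀ i, v i ⬝ᵥ z = t i := by
  let φ : (Fin m → ZMod p) →ₗ[ZMod p] (Fin 3 → ZMod p) :=
    { toFun := fun z i => v i ⬝ᵥ z
      map_add' := fun x y => by ext i; exact dotProduct_add _ _ _
      map_smul' := fun c x => by ext i; simp }
  have hr : LinearMap.range φ = ⊤ := by
    by_contra hcon
    obtain ⟨f, hf0, hf⟩ := Submodule.exists_le_ker_of_lt_top _ (lt_top_iff_ne_top.2 hcon)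
    apply hf0
    have hfe : ∀ x : Fin 3 → ZMod p, f x = ∑ i, x i * f (Pi.single i 1) := by
      intro x
      conv_lhs => rw [← Finset.univ_sum_single x]
      rw [map_sum]
      refine Finset.sum_congr rfl fun i _ => ?_
      have : (Pi.single i (x i) : Fin 3 → ZMod p) = x i • Pi.single i 1 := by
        rw [← Pi.single_smul]; simp
      rw [this, map_smul, smul_eq_mul]
    have ha := hv (fun i => f (Pi.single i 1)) (by
      apply dotProduct_eq_zero _ 
      intro z
      have : f (φ z) = 0 := hf ⟨z, rfl⟩
      rw [hfe] at this
      rw [sum_dotProduct]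
      rw [← this]
      refine Finset.sum_congr rfl fun i _ => ?_
      rw [smul_dotProduct, smul_eq_mul, mul_comm]
      rfl)
    ext i
    simpa using congrFun ha i
  obtain ⟨z, hz⟩ := LinearMap.range_eq_top.1 hr t
  exact ⟨z, fun i => congrFun hz i⟩

theorem triple_sum {p m : ℕ} [Fact p.Prime] (v : Fin 3 → (Fin m → ZMod p))
    (hv : ∀ a : Fin 3 → ZMod p, ∑ i, a i • v i = 0 → a = 0) (g : Fin 3 → ZMod p → ℝ) :
    (p:ℝ)^3 * ∑ z, ∏ i, g i (v i ⬝ᵥ z) = (p:ℝ)^m * ∏ i, ∑ t, g i t := by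
  let φ : (Fin m → ZMod p) →+ (Fin 3 → ZMod p) :=
    { toFun := fun z i => v i ⬝ᵥ z
      map_zero' := by ext i; simp
      map_add' := fun x y => by ext i; exact dotProduct_add _ _ _ }
  have := sum_comp_surj φ (fun t => by
    obtain ⟨z, hz⟩ := triple_surj v hv t
    exact ⟨z, funext hz⟩) (fun t => ∏ i, g i (t i))
  rw [Finset.prod_univ_sum, Fintype.piFinset_univ]
  simp only [Fintype.card_fun, Fintype.card_fin, ZMod.card, Nat.cast_pow] at this
  exact this

theorem single_sum {p m : ℕ} [Fact p.Prime] (v : Fin m → ZMod p) (hv : v ≠ 0) (g : ZMod p → ℝ) :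
    (p:ℝ) * ∑ z, g (v ⬝ᵥ z) = (p:ℝ)^m * ∑ t, g t := by
  let φ : (Fin m → ZMod p) →+ ZMod p :=
    { toFun := fun z => v ⬝ᵥ z
      map_zero' := by simp
      map_add' := fun x y => dotProduct_add _ _ _ }
  have := sum_comp_surj φ (fun t => by
    obtain ⟨z, hz⟩ := dot_surj v hv t
    exact ⟨z, by rw [← hz, dotProduct_comm]; rfl⟩) g
  simp only [Fintype.card_fun, Fintype.card_fin, ZMod.card, Nat.cast_pow] at this
  exact this

theorem step {p m : ℕ} [Fact p.Prime] {Y : Type*} [AddCommGroup Y] [Fintype Y] [DecidableEq Y]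
    [Nontrivial Y] (h2 : ∀ d : Y, d ≠ 0 → 2 • d ≠ 0)
    (h : ZMod p → ℝ) (h0 : ∀ x, 0 ≤ h x) (h1 : ∀ x, h x ≤ 3/2) (hs : ∑ x, h x = p)
    {F : Y → ℝ} {κ σ δ : ℝ} (hF : Good F κ σ δ) (hκ1 : 1 ≤ κ) (hκ2 : κ ≤ 10/9) (hδ : δ ≤ σ) (hσ : 0 ≤ σ)
    (P : Finset Y) (hPκ : ∀ y ∈ P, F y = κ) (hP1 : 256 * σ * Fintype.card Y ≤ P.card)
    (hP2 : P.card ≤ 257 * σ * Fintype.card Y)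
    (v : Y → (Fin m → ZMod p))
    (hv1 : ∀ f : Fin 3 → Y, Function.Injective f → ∀ a : Fin 3 → ZMod p, ∑ i, a i • v (f i) = 0 → a = 0)
    (hv2 : ∀ d : Fin m → ZMod p, d ≠ 0 →
      ∑ y ∈ P, (1 / (p:ℝ) * ∑ s, h s * h (s + v y ⬝ᵥ d) * h (s + 2 * (v y ⬝ᵥ d))) ≤ 127/128 * P.card) :
    ∃ F' : Y × (Fin m → ZMod p) → ℝ, Good F' κ (1024 * σ) δ := by
  have hp : p.Prime := Fact.out
  have hp0 : (0:ℝ) < p := by exact_mod_cast hp.pos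
  have hpm : (0:ℝ) < (p:ℝ)^m := by positivity
  let Gf : Y → ZMod p → ℝ := fun y t => if y ∈ P then κ * h t else F y
  have hGs : ∀ y, ∑ t, Gf y t = p * F y := by
    intro y
    simp only [Gf]
    split_ifs with hy
    · rw [← Finset.mul_sum, hs, hPκ y hy, mul_comm]
    · simp
  have hinj : ∀ y d : Y, d ≠ 0 → Function.Injective ![y, y + d, y + 2 • d] := by
    intro y d hd i j hij
    have a1 := h2 d hd
    have a2 : d ≠ 2 • d := by rw [two_nsmul]; simpa using hd
    clear h2 hv1 hv2
    fin_cases i <;> fin_cases j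
    · rfl
    · exact absurd (left_eq_add.1 hij) hd
    · exact absurd (left_eq_add.1 hij) a1
    · exact absurd (add_eq_left.1 hij) hd
    · rfl
    · exact absurd (add_left_cancel hij) a2
    · exact absurd (add_eq_left.1 hij) a1
    · exact absurd (add_left_cancel hij).symm a2
    · rfl
  have hv0 : ∀ y, v y ≠ 0 := by
    intro y hy
    obtain ⟨d, hd⟩ := exists_ne (0:Y)
    have := hv1 _ (hinj y d hd) ![1,0,0] (by simp [Fin.sum_univ_three, hy])
    have := congrFun this 0
    simp at this
  have hsing : ∀ (y : Y) (g : ZMod p → ℝ), ∑ z, g (v y ⬝ᵥ z) = (p:ℝ)^m * (1/p * ∑ t, g t) := by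
    intro y g
    have := single_sum (v y) (hv0 y) g
    field_simp; linarith
  have hcard : (Fintype.card (Y × (Fin m → ZMod p)) : ℝ) = Fintype.card Y * (p:ℝ)^m := by
    rw [Fintype.card_prod]; simp [ZMod.card]
  have hκ3 : κ^3 ≤ 3/2 := by
    calc κ^3 ≤ (10/9)^3 := pow_le_pow_left₀ (by linarith) hκ2 3
      _ ≤ _ := by norm_num
  have hκ3' : 1 ≤ κ^3 := one_le_pow₀ hκ1
  have hsplit : ∀ g : Y → ℝ, ∑ y, g y = ∑ y ∈ P, g y + ∑ y ∈ Pᶜ, g y := fun g =>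
    (Finset.sum_add_sum_compl P g).symm
  have hFP : ∑ y ∈ P, F y ^ 3 = κ^3 * P.card := by
    rw [Finset.sum_congr rfl (fun y hy => by rw [hPκ y hy]), Finset.sum_const, nsmul_eq_mul, mul_comm]
  have hcube := hF.cube
  rw [hsplit, hFP] at hcube
  have hY0 : (0:ℝ) ≤ Fintype.card Y := Nat.cast_nonneg _
  have hP0 : (0:ℝ) ≤ P.card := Nat.cast_nonneg _
  refine ⟨fun x => Gf x.1 (v x.1 ⬝ᵥ x.2), ?_, ?_, ?_, ?_, ?_, ?_⟩
  · rintro ⟨y, z⟩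
    simp only [Gf]
    split_ifs
    · exact mul_nonneg (by linarith) (h0 _)
    · exact hF.nonneg _
  · rintro ⟨y, z⟩
    simp only [Gf]
    split_ifs
    · nlinarith [h0 (v y ⬝ᵥ z), h1 (v y ⬝ᵥ z)]
    · exact hF.le _
  · rw [hcard, Fintype.sum_prod_type]
    simp only [hsing, hGs]
    rw [← Finset.mul_sum, ← Finset.mul_sum, ← Finset.mul_sum, hF.sum]; field_simp
  · rintro ⟨d, d'⟩ hd
    rw [hcard]
    unfold Lam
    rw [Fintype.sum_prod_type]
    by_cases hd0 : d = 0
    · subst hd0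
      have hd' : d' ≠ 0 := by rintro rfl; exact hd rfl
      simp only [Prod.mk_add_mk, Prod.smul_mk, smul_zero, add_zero, dotProduct_add, dotProduct_smul]
      have e1 : ∀ y ∈ P, ∑ z, Gf y (v y ⬝ᵥ z) * Gf y (v y ⬝ᵥ z + v y ⬝ᵥ d') * Gf y (v y ⬝ᵥ z + 2 • (v y ⬝ᵥ d'))
          = (p:ℝ)^m * κ^3 * (1 / (p:ℝ) * ∑ s, h s * h (s + v y ⬝ᵥ d') * h (s + 2 * (v y ⬝ᵥ d'))) := by
        intro y hy
        rw [hsing y (fun t => Gf y t * Gf y (t + v y ⬝ᵥ d') * Gf y (t + 2 • (v y ⬝ᵥ d')))]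
        have : ∀ t, Gf y t * Gf y (t + v y ⬝ᵥ d') * Gf y (t + 2 • (v y ⬝ᵥ d')) =
          κ^3 * (h t * h (t + v y ⬝ᵥ d') * h (t + 2 * (v y ⬝ᵥ d'))) := by
          intro t; simp only [Gf, if_pos hy, nsmul_eq_mul, Nat.cast_ofNat]; ring
        simp only [this]
        rw [← Finset.mul_sum]; ring
      have e2 : ∀ y ∈ Pᶜ, ∑ z, Gf y (v y ⬝ᵥ z) * Gf y (v y ⬝ᵥ z + v y ⬝ᵥ d') * Gf y (v y ⬝ᵥ z + 2 • (v y ⬝ᵥ d'))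
          = (p:ℝ)^m * F y ^3 := by
        intro y hy
        rw [Finset.mem_compl] at hy
        simp only [Gf, if_neg hy]
        simp only [Finset.sum_const, Finset.card_univ, nsmul_eq_mul, Fintype.card_fun, Fintype.card_fin, ZMod.card, Nat.cast_pow]; ring
      rw [hsplit, Finset.sum_congr rfl e1, Finset.sum_congr rfl e2]
      have := hv2 d' hd'
      set A := ∑ y ∈ P, (1 / (p:ℝ) * ∑ s, h s * h (s + v y ⬝ᵥ d') * h (s + 2 * (v y ⬝ᵥ d')))
      set B := ∑ y ∈ Pᶜ, F y ^ 3
      have : κ^3 * A + B ≤ (1 - δ) * Fintype.card Y := by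
        have b1 : κ^3 * A ≤ κ^3 * (127/128 * P.card) := mul_le_mul_of_nonneg_left this (by linarith)
        have b2 : δ * Fintype.card Y ≤ σ * Fintype.card Y := mul_le_mul_of_nonneg_right hδ hY0
        nlinarith [mul_le_mul_of_nonneg_right hκ3' hP0]
      calc _ = (p:ℝ)^m * (κ^3 * A + B) := by
            rw [mul_add, ← mul_assoc, Finset.mul_sum P, Finset.mul_sum Pᶜ]
        _ ≤ (p:ℝ)^m * ((1 - δ) * Fintype.card Y) := mul_le_mul_of_nonneg_left this hpm.le
        _ = _ := by ring
    · have e : ∀ y, ∑ z, Gf y (v y ⬝ᵥ z) * Gf (y + d) (v (y + d) ⬝ᵥ (z + d')) *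
            Gf (y + 2 • d) (v (y + 2 • d) ⬝ᵥ (z + 2 • d')) = (p:ℝ)^m * (F y * F (y+d) * F (y + 2 • d)) := by
        intro y
        have t := triple_sum (fun i => v (![y, y + d, y + 2 • d] i)) (hv1 _ (hinj y d hd0))
          ![fun t => Gf y t, fun t => Gf (y+d) (t + v (y+d) ⬝ᵥ d'),
            fun t => Gf (y+2 • d) (t + v (y+2 • d) ⬝ᵥ (2 • d'))]
        simp only [Fin.prod_univ_three, Matrix.cons_val_zero, Matrix.cons_val_one, Matrix.cons_val] at t
        have s1 : ∑ t, Gf (y+d) (t + v (y+d) ⬝ᵥ d') = p * F (y+d) := by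
          rw [← hGs]; exact Equiv.sum_comp (Equiv.addRight (v (y+d) ⬝ᵥ d')) (Gf (y+d))
        have s2 : ∑ t, Gf (y+2 • d) (t + v (y+2 • d) ⬝ᵥ (2 • d')) = p * F (y+2 • d) := by
          rw [← hGs]; exact Equiv.sum_comp (Equiv.addRight (v (y+2 • d) ⬝ᵥ (2 • d'))) (Gf (y+2 • d))
        rw [hGs, s1, s2] at t
        simp only [dotProduct_add]
        have hp3 : (p:ℝ)^3 ≠ 0 := by positivity
        apply mul_left_cancel₀ hp3
        rw [t]; ring
      simp only [Prod.mk_add_mk, Prod.smul_mk]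
      simp only [e]
      rw [← Finset.mul_sum]
      have := hF.lam d hd0
      unfold Lam at this
      calc _ ≤ (p:ℝ)^m * ((1 - δ) * Fintype.card Y) := mul_le_mul_of_nonneg_left this hpm.le
        _ = _ := by ring
  · rw [hcard, Fintype.sum_prod_type]
    have e1 : ∀ y ∈ P, ∑ z, Gf y (v y ⬝ᵥ z) ^ 3 ≤ (p:ℝ)^m * (27/8) := by
      intro y hy
      rw [hsing y (fun t => Gf y t ^3)]
      apply mul_le_mul_of_nonneg_left _ hpm.le
      have : ∑ t, Gf y t ^3 ≤ ∑ t, κ^3 * (9/4) * h t := by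
        refine Finset.sum_le_sum fun t _ => ?_
        simp only [Gf, if_pos hy]
        rw [mul_pow, mul_assoc]
        apply mul_le_mul_of_nonneg_left _ (by linarith)
        have := mul_nonneg (h0 t) (sub_nonneg.2 (h1 t))
        nlinarith [h0 t, h1 t]
      rw [← Finset.mul_sum, hs] at this
      rw [one_div, inv_mul_le_iff₀ hp0]
      nlinarith
    have e2 : ∀ y ∈ Pᶜ, ∑ z, Gf y (v y ⬝ᵥ z) ^ 3 = (p:ℝ)^m * F y ^3 := by
      intro y hy
      rw [Finset.mem_compl] at hy
      simp only [Gf, if_neg hy]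
      simp [ZMod.card]
    have e1' := Finset.sum_le_sum e1
    rw [hsplit, Finset.sum_congr rfl e2, ← Finset.mul_sum]
    rw [Finset.sum_const, nsmul_eq_mul] at e1'
    set B := ∑ y ∈ Pᶜ, F y ^ 3
    have : P.card * (27/8) + B ≤ (1 + 1024 * σ) * Fintype.card Y := by
      nlinarith [mul_le_mul_of_nonneg_right hκ3' hP0]
    calc _ ≤ (p:ℝ)^m * (P.card * (27/8) + B) := by linarith
        _ ≤ (p:ℝ)^m * ((1 + 1024 * σ) * Fintype.card Y) := mul_le_mul_of_nonneg_left this hpm.le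
        _ = _ := by ring
  · obtain ⟨U, hU1, hU2⟩ := hF.unp
    refine ⟨(U \ P) ×ˢ Finset.univ, ?_, ?_⟩
    · rintro ⟨y, z⟩ hx
      simp only [Finset.mem_product, Finset.mem_sdiff, Finset.mem_univ, and_true] at hx
      simp only [Gf, if_neg hx.2, hU1 y hx.1]
    · rw [hcard, Finset.card_product, Finset.card_univ]
      have : U.card ≤ (U \ P).card + P.card := by
        have := Finset.le_card_sdiff P U; omega
      have : (U.card : ℝ) ≤ (U \ P).card + P.card := by exact_mod_cast this
      have hc : (Fintype.card (Fin m → ZMod p) : ℝ) = (p:ℝ)^m := by simp [ZMod.card]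
      rw [Nat.cast_mul, hc, ← mul_assoc]
      apply mul_le_mul_of_nonneg_right _ hpm.le
      nlinarith [mul_nonneg hσ hY0]

theorem two_nsmul_ne {p n : ℕ} [Fact p.Prime] (hodd : Odd p) (d : Fin n → ZMod p) (hd : d ≠ 0) : 2 • d ≠ 0 := by
  intro h
  apply hd
  have h2 : (2 : ZMod p) ≠ 0 := by
    intro h
    have : ((2:ℕ) : ZMod p) = 0 := by exact_mod_cast h
    rw [ZMod.natCast_eq_zero_iff] at this
    have := (Nat.prime_dvd_prime_iff_eq Fact.out Nat.prime_two).1 this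
    subst this
    exact absurd hodd (by decide)
  ext i
  have := congrFun h i
  simpa [h2] using this

theorem stepFin {p n m : ℕ} [Fact p.Prime] (hodd : Odd p) (hn : 1 ≤ n)
    {F : (Fin n → ZMod p) → ℝ} {κ σ δ : ℝ} (hF : Good F κ σ δ) (hκ1 : 1 ≤ κ) (hκ2 : κ ≤ 10/9) (hδ : δ ≤ σ)
    (hσ : 0 ≤ σ) (hσ1 : 258 * σ ≤ 1) (hm : 3 * n + 4 ≤ m) (hq : 2^12 * (m:ℝ) * p ≤ σ * (p:ℝ)^n) :
    ∃ F' : (Fin (n + m) → ZMod p) → ℝ, Good F' κ (1024 * σ) δ := by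
  have hp : p.Prime := Fact.out
  have hp0 : (0:ℝ) < p := by exact_mod_cast hp.pos
  have hp2 : (2:ℝ) ≤ p := by exact_mod_cast hp.two_le
  have hm1 : (1:ℝ) ≤ m := by exact_mod_cast (by omega : 1 ≤ m)
  obtain ⟨h, h0, h1, hs, hl⟩ := exists_h p hodd
  have hcY : (Fintype.card (Fin n → ZMod p) : ℝ) = (p:ℝ)^n := by simp [ZMod.card]
  haveI : Nonempty (Fin n) := ⟨⟨0, hn⟩⟩
  have hq1 : 1 ≤ σ * (p:ℝ)^n := by nlinarith
  obtain ⟨U, hU1, hU2⟩ := hF.unp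
  rw [hcY] at hU2
  obtain ⟨P, hPU, hPc⟩ : ∃ P ⊆ U, P.card = ⌈256 * σ * (p:ℝ)^n⌉₊ := by
    apply Finset.exists_subset_card_eq
    rw [Nat.ceil_le]
    have : (258*σ) * (p:ℝ)^n ≤ 1 * (p:ℝ)^n := mul_le_mul_of_nonneg_right hσ1 (by positivity)
    nlinarith
  have hP1 : 256 * σ * (p:ℝ)^n ≤ P.card := by rw [hPc]; exact Nat.le_ceil _
  have hP2 : (P.card:ℝ) ≤ 257 * σ * (p:ℝ)^n := by
    rw [hPc]
    have := Nat.ceil_lt_add_one (a := 256 * σ * (p:ℝ)^n) (by nlinarith)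
    nlinarith
  have hlog : Real.log p + 1 ≤ p := by linarith [Real.log_le_sub_one_of_pos hp0]
  obtain ⟨v, hv1, hv2⟩ := exists_code p m (Y := Fin n → ZMod p)
    (fun t => 1 / (p:ℝ) * ∑ s, h s * h (s + t) * h (s + 2 * t))
    (fun t => mul_nonneg (by positivity) (Finset.sum_nonneg fun s _ =>
      mul_nonneg (mul_nonneg (h0 _) (h0 _)) (h0 _)))
    (fun t => by
      rw [one_div, inv_mul_le_iff₀ hp0]
      have : ∑ s, h s * h (s + t) * h (s + 2 * t) ≤ ∑ s, h s * (9/4) := by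
        refine Finset.sum_le_sum fun s _ => ?_
        rw [mul_assoc]
        apply mul_le_mul_of_nonneg_left _ (h0 s)
        nlinarith [h0 (s+t), h0 (s+2*t), h1 (s+t), h1 (s+2*t)]
      rw [← Finset.sum_mul, hs] at this
      exact this)
    (by
      rw [← Finset.mul_sum, one_div, inv_mul_le_iff₀ hp0]
      nlinarith)
    P
    (by
      have : (m:ℝ) * Real.log p + 1 ≤ m * p := by nlinarith
      nlinarith)
    (by
      rw [hcY]
      calc 2 * ((p:ℝ)^n * p)^3 ≤ p * ((p:ℝ)^n * p)^3 := mul_le_mul_of_nonneg_right hp2 (by positivity)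
        _ = (p:ℝ)^(3*n+4) := by ring
        _ ≤ _ := pow_le_pow_right₀ (by linarith) hm)
  obtain ⟨F', hF'⟩ := step (two_nsmul_ne hodd) h h0 h1 hs hF hκ1 hκ2 hδ hσ P (fun y hy => hU1 y (hPU hy))
    (by rw [hcY]; exact hP1) (by rw [hcY]; exact hP2) v hv1 hv2
  let e : (Fin (n+m) → ZMod p) ≃ₗ[ZMod p] (Fin n → ZMod p) × (Fin m → ZMod p) :=
    (LinearEquiv.funCongrLeft (ZMod p) (ZMod p) finSumFinEquiv).trans
      (LinearEquiv.sumArrowLequivProdArrow (Fin n) (Fin m) (ZMod p) (ZMod p))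
  exact ⟨_, hF'.transfer e.toAddEquiv⟩

theorem base {p n : ℕ} [Fact p.Prime] (hodd : Odd p) (σ : ℝ) (hN : (10:ℝ) ≤ (p:ℝ)^n) (hσ : 4 ≤ σ * (p:ℝ)^n) :
    ∃ F : (Fin n → ZMod p) → ℝ, ∃ κ : ℝ, 1 ≤ κ ∧ κ ≤ 10/9 ∧ Good F κ σ (3/((p:ℝ)^n)^2) := by
  classical
  have hcY : (Fintype.card (Fin n → ZMod p) : ℝ) = (p:ℝ)^n := by simp [ZMod.card]
  set N := (p:ℝ)^n with hNd
  have hN1 : 0 < N - 1 := by linarith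
  have key : ∀ (c : ℝ) (S : Finset (Fin n → ZMod p)), ∑ x, (if x ∈ S then 0 else c) = c * (N - S.card) := by
    intro c S
    have : ∀ x, (if x ∈ S then 0 else c) = c - (if x ∈ S then c else 0) := by
      intro x; split_ifs <;> simp
    simp only [this, Finset.sum_sub_distrib]
    rw [Finset.sum_ite_mem, Finset.univ_inter, Finset.sum_const, Finset.sum_const, Finset.card_univ,
      nsmul_eq_mul, nsmul_eq_mul, hcY]; ring
  set κ := N / (N-1) with hκd
  have hκ1 : 1 ≤ κ := by rw [hκd, le_div_iff₀ hN1]; linarith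
  have hκ2 : κ ≤ 10/9 := by rw [hκd, div_le_iff₀ hN1]; linarith
  have hκm : κ * (N - 1) = N := by rw [hκd]; field_simp
  refine ⟨fun x => if x ∈ ({0} : Finset (Fin n → ZMod p)) then 0 else κ, κ, hκ1, hκ2, ?_, ?_, ?_, ?_, ?_, ?_⟩
  · intro x; split_ifs <;> linarith
  · intro x; split_ifs <;> linarith
  · rw [key, hcY]; simp [hκm]
  · intro d hd
    have h2 := two_nsmul_ne hodd d hd
    have a2 : d ≠ 2 • d := by rw [two_nsmul]; simpa using hd
    unfold Lam
    have : ∀ x : Fin n → ZMod p, (if x ∈ ({0} : Finset (Fin n → ZMod p)) then 0 else κ) *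
       (if x + d ∈ ({0} : Finset (Fin n → ZMod p)) then 0 else κ) *
       (if x + 2 • d ∈ ({0} : Finset (Fin n → ZMod p)) then 0 else κ) =
       if x ∈ ({0, -d, -(2 • d)} : Finset (Fin n → ZMod p)) then 0 else κ^3 := by
      intro x
      simp only [Finset.mem_insert, Finset.mem_singleton, add_eq_zero_iff_eq_neg]
      by_cases b1 : x = 0
      · simp [b1]
      by_cases b2 : x = -d
      · simp [b2]
      by_cases b3 : x = -(2 • d)
      · rw [if_pos b3]; rw [if_pos (Or.inr (Or.inr b3))]; ring
      rw [if_neg b1, if_neg b2, if_neg b3, if_neg (by tauto)]; ring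
    simp only [this]
    have hc : ({0, -d, -(2 • d)} : Finset (Fin n → ZMod p)).card = 3 := by
      rw [Finset.card_eq_three]
      refine ⟨0, -d, -(2•d), ?_, ?_, ?_, rfl⟩
      · exact fun h => hd (neg_eq_zero.1 h.symm)
      · exact fun h => h2 (neg_eq_zero.1 h.symm)
      · exact fun h => a2 (neg_injective h)
    rw [key, hc, hcY]
    have e1 : κ^3 * (N - 3) = N^3 * (N-3) / (N-1)^3 := by rw [hκd, div_pow]; ring
    push_cast
    rw [e1, div_le_iff₀ (by positivity)]
    have e2 : (1 - 3/N^2) * N = (N^2-3)/N := by field_simp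
    rw [e2, div_mul_eq_mul_div, le_div_iff₀ (by linarith)]
    nlinarith [mul_pos hN1 hN1, mul_pos (mul_pos hN1 hN1) hN1, mul_nonneg (sub_nonneg.2 hN) (mul_pos hN1 hN1).le]
  · have : ∀ x : Fin n → ZMod p, (if x ∈ ({0} : Finset (Fin n → ZMod p)) then 0 else κ)^3 =
      if x ∈ ({0} : Finset (Fin n → ZMod p)) then 0 else κ^3 := by
      intro x; split_ifs <;> simp
    simp only [this]
    rw [key, hcY]
    simp only [Finset.card_singleton, Nat.cast_one]
    have : κ^3 * (N-1) = κ^2 * N := by linear_combination κ^2 * hκm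
    rw [this]
    have : κ^2 * N ≤ N + 4 := by
      have : κ * N = N + κ := by linarith
      nlinarith
    linarith
  · refine ⟨{0}ᶜ, ?_, ?_⟩
    · intro x hx
      exact if_neg (Finset.mem_compl.1 hx)
    · rw [hcY, Finset.card_compl, Nat.cast_sub (Finset.card_le_univ _), hcY]
      simp; linarith

def eSeq (p W : ℕ) : ℕ → ℕ
  | 0 => 0
  | i + 1 => eSeq p W i + W * p ^ eSeq p W i

theorem eSeq_ge {p W : ℕ} (hp : 1 ≤ p) (hW : 1 ≤ W) (i : ℕ) : W * towerP p i ≤ eSeq p W (i+1) := by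
  induction i with
  | zero => simp [eSeq, towerP]
  | succ i ih =>
    rw [eSeq, towerP]
    have h1 : towerP p i ≤ eSeq p W (i+1) := le_trans (Nat.le_mul_of_pos_left _ hW) ih
    have := Nat.mul_le_mul_left W (Nat.pow_le_pow_right hp h1)
    omega

theorem iter {p n W : ℕ} [Fact p.Prime] (hodd : Odd p) (hn : 1 ≤ n) {κ σ δ : ℝ}
    (h0 : ∃ F : (Fin n → ZMod p) → ℝ, Good F κ σ δ) (hκ1 : 1 ≤ κ) (hκ2 : κ ≤ 10/9)
    (hδ : δ ≤ σ) (hσ : 0 ≤ σ) (I : ℕ) (hI : ∀ i < I, 258 * (1024^i * σ) ≤ 1) (hW : 3 * n + 4 ≤ W)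
    (hX : 2^12 * (W:ℝ) * p ≤ σ * (p:ℝ)^n) (i : ℕ) (hi : i ≤ I) :
    ∃ F : (Fin (n + eSeq p W i) → ZMod p) → ℝ, Good F κ (1024^i * σ) δ := by
  have hp : p.Prime := Fact.out
  induction i with
  | zero => rw [pow_zero, one_mul]; exact h0
  | succ i ih =>
    obtain ⟨F, hF⟩ := ih (by omega)
    rw [eSeq, ← add_assoc, pow_succ', mul_assoc]
    have h1 : (1:ℝ) ≤ 1024^i := one_le_pow₀ (by norm_num)
    have h2 : σ ≤ 1024^i * σ := by nlinarith
    refine stepFin hodd (by omega) hF hκ1 hκ2 (hδ.trans h2) (hσ.trans h2) (hI i (by omega)) ?_ ?_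
    · have h3 : eSeq p W i + 1 ≤ p ^ eSeq p W i := Nat.lt_pow_self hp.one_lt
      have := Nat.mul_le_mul_left W h3
      nlinarith
    · push_cast
      have hpp : (0:ℝ) ≤ (p:ℝ)^(eSeq p W i) := by positivity
      calc 2^12 * ((W:ℝ) * p ^ eSeq p W i) * p = 2^12 * (W:ℝ) * p * p ^ eSeq p W i := by ring
        _ ≤ σ * (p:ℝ)^n * p ^ eSeq p W i := mul_le_mul_of_nonneg_right hX hpp
        _ ≤ (1024^i*σ) * (p:ℝ)^n * p ^ eSeq p W i := by gcongr
        _ = _ := by rw [pow_add]; ring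

def indS {X : Type*} (S : Finset X) [DecidableEq X] (ω : X → Bool) : ℝ := ∏ i ∈ S, (if ω i = true then 1 else 0)

theorem wE_indS {X : Type*} [Fintype X] [DecidableEq X] (w : X → Bool → ℝ) (h1 : ∀ i, ∑ k, w i k = 1)
    (S : Finset X) : wE w (indS S) = ∏ i ∈ S, w i true := by
  have e : ∀ ω : X → Bool, (∏ i, w i (ω i)) * indS S ω =
      ∏ i, (w i (ω i) * if i ∈ S then (if ω i = true then 1 else 0) else 1) := by
    intro ω
    rw [Finset.prod_mul_distrib, Finset.prod_ite_mem, Finset.univ_inter, indS]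
  unfold wE
  simp only [e]
  have := Finset.prod_univ_sum (fun _ : X => (Finset.univ : Finset Bool))
    (fun i k => (w i k * if i ∈ S then (if k = true then 1 else 0) else 1 : ℝ))
  rw [Fintype.piFinset_univ] at this
  rw [← this]
  have e2 : ∀ i, ∑ k, (w i k * if i ∈ S then (if k = true then 1 else 0) else 1 : ℝ) =
      if i ∈ S then w i true else 1 := by
    intro i
    split_ifs with hi
    · simp
    · simpa using h1 i
  simp only [e2]
  rw [Finset.prod_ite_mem, Finset.univ_inter]

theorem indS_01 {X : Type*} [DecidableEq X] (S : Finset X) (ω : X → Bool) : 0 ≤ indS S ω ∧ indS S ω ≤ 1 := by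
  constructor
  · exact Finset.prod_nonneg fun i _ => by split_ifs <;> norm_num
  · exact Finset.prod_le_one (fun i _ => by split_ifs <;> norm_num) (fun i _ => by split_ifs <;> norm_num)

theorem indS_diff {X : Type*} [DecidableEq X] (S : Finset X) (ω : X → Bool) (i : X) (k : Bool) :
    |indS S (Function.update ω i k) - indS S ω| ≤ if i ∈ S then 1 else 0 := by
  split_ifs with h
  · have a := indS_01 S ω
    have b := indS_01 S (Function.update ω i k)
    rw [abs_le]; constructor <;> linarith
  · have : indS S (Function.update ω i k) = indS S ω := by
      refine Finset.prod_congr rfl fun j hj => ?_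
      rw [Function.update_of_ne]
      rintro rfl; exact h hj
    simp [this]

theorem indS_tail {X : Type*} [Fintype X] [DecidableEq X] [Nonempty X] (w : X → Bool → ℝ) (hw : ∀ i k, 0 ≤ w i k)
    (h1 : ∀ i, ∑ k, w i k = 1) (S : X → Finset X) (hS : ∀ i, (Finset.univ.filter fun x => i ∈ S x).card ≤ 3)
    (s : ℝ) (hs : |s| = 1) (t : ℝ) (ht0 : 0 ≤ t) (ht1 : t ≤ 1) (B : Finset (X → Bool))
    (hB : ∀ ω ∈ B, s * ((∑ x, ∏ i ∈ S x, w i true) / Fintype.card X) + t ≤ s * ((∑ x, indS (S x) ω) / Fintype.card X)) :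
    ∑ ω ∈ B, ∏ i, w i (ω i) ≤ Real.exp (- (t^2 * Fintype.card X / 36)) := by
  set N := ((Fintype.card X : ℕ) : ℝ) with hN
  have hN0 : 0 < N := by rw [hN]; exact_mod_cast Fintype.card_pos
  have := tail w hw h1 (fun _ => 3/N) (fun ω => s * ((∑ x, indS (S x) ω) / N)) (by
    intro ω i k
    rw [← mul_sub, ← sub_div, ← Finset.sum_sub_distrib, abs_mul, hs, one_mul, abs_div, abs_of_pos hN0]
    apply div_le_div_of_nonneg_right _ hN0.le
    calc _ ≤ ∑ x, |indS (S x) (Function.update ω i k) - indS (S x) ω| := Finset.abs_sum_le_sum_abs _ _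
      _ ≤ ∑ x, if i ∈ S x then (1:ℝ) else 0 := Finset.sum_le_sum fun x _ => indS_diff _ _ _ _
      _ = (Finset.univ.filter fun x => i ∈ S x).card := by rw [Finset.sum_boole]
      _ ≤ 3 := by exact_mod_cast hS i) (t * N / 18) t (by positivity) (by
    intro i
    have : t * N / 18 * (3 / N) = t / 6 := by field_simp; ring
    rw [this]; linarith) B (by
    intro ω hω
    have e : wE w (fun ω => s * ((∑ x, indS (S x) ω) / N)) = s * ((∑ x, ∏ i ∈ S x, w i true) / N) := by
      have : ∀ x, ∏ i ∈ S x, w i true = wE w (indS (S x)) := fun x => (wE_indS w h1 _).symm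
      simp only [this]
      unfold wE
      rw [Finset.sum_comm, Finset.sum_div, Finset.mul_sum]
      refine Finset.sum_congr rfl fun ω _ => ?_
      rw [← Finset.mul_sum]; ring
    rw [e]
    exact hB ω hω)
  refine this.trans (Real.exp_le_exp.2 (le_of_eq ?_))
  rw [Finset.sum_const, Finset.card_univ, nsmul_eq_mul, ← hN]
  field_simp; ring

theorem exp_big {N y : ℝ} (hy : 1 ≤ y) (hyN : N ≤ y^2) : (N + 1) * Real.exp (-y) < 1 := by
  have h := Real.sum_le_exp_of_nonneg (x := y) (by linarith) 4
  simp [Finset.sum_range_succ, Nat.factorial] at h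
  rw [Real.exp_neg, ← div_eq_mul_inv, div_lt_one (Real.exp_pos _)]
  nlinarith [mul_pos (by linarith : 0 < y) (by nlinarith [sq_nonneg (y - 3/2)] : 0 < 1 - y/2 + y^2/6)]

theorem sampling {p n : ℕ} [Fact p.Prime] (hodd : Odd p) {F : (Fin n → ZMod p) → ℝ} {κ σ δ : ℝ}
    (hF : Good F κ σ δ) (α : ℝ) (hα0 : 0 < α) (hα : α ≤ 1/2) (hδ0 : 0 < δ) (hδ1 : δ ≤ 1/4)
    (hN : 1296 ≤ (α^3 * δ / 16)^4 * (p:ℝ)^n) :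
    ∃ A : Finset (Fin n → ZMod p),
        α ≤ (A.card : ℝ) / (p : ℝ) ^ n ∧
        ∀ d : Fin n → ZMod p, d ≠ 0 →
          (((Finset.univ.filter fun x : Fin n → ZMod p =>
                x ∈ A ∧ x + d ∈ A ∧ x + 2 • d ∈ A).card : ℝ) / (p : ℝ) ^ n)
            < α ^ 3 * (1 - δ / 2) := by
  classical
  have hcY : (Fintype.card (Fin n → ZMod p) : ℝ) = (p:ℝ)^n := by simp [ZMod.card]
  have hp : p.Prime := Fact.out
  have hp0 : (0:ℝ) < p := by exact_mod_cast hp.pos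
  have hN1 : (1:ℝ) ≤ (p:ℝ)^n := one_le_pow₀ (by exact_mod_cast hp.one_le)
  set N := (p:ℝ)^n with hNd
  set t := α^3 * δ / 16 with htd
  set a := α * (1 + δ/16) with had
  have ha0 : 0 < a := by positivity
  have ha1 : a ≤ 3/5 := by
    rw [had]; nlinarith
  have hα3 : α^3 ≤ α := by nlinarith [mul_pos hα0 hα0]
  have ht0 : 0 < t := by positivity
  have ht1 : t ≤ 1 := by rw [htd]; nlinarith [pow_pos hα0 3]
  set w : (Fin n → ZMod p) → Bool → ℝ := fun x b => if b = true then a * F x else 1 - a * F x with hwd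
  have hw : ∀ i k, 0 ≤ w i k := by
    intro i k
    have := hF.nonneg i
    have := hF.le i
    have : a * F i ≤ 3/5 * (5/3) := mul_le_mul ha1 (hF.le i) (hF.nonneg i) (by norm_num)
    simp only [w]
    split_ifs
    · exact mul_nonneg ha0.le (hF.nonneg i)
    · linarith
  have h1 : ∀ i, ∑ k, w i k = 1 := by intro i; simp [w]
  set y := t^2 * N / 36 with hyd
  have hyN : N ≤ y^2 := by
    have : y^2 = t^4 * N * N / 1296 := by rw [hyd]; ring
    rw [this, le_div_iff₀ (by norm_num)]
    nlinarith
  have hy0 : 0 ≤ y := by positivity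
  have hy1 : 1 ≤ y := by nlinarith
  have hbeta := exp_big hy1 hyN
  set S : (Fin n → ZMod p) → (Fin n → ZMod p) → Finset (Fin n → ZMod p) := fun d x => {x, x + d, x + 2 • d}
  obtain ⟨ω, hω⟩ := union_exists (J := Option (Fin n → ZMod p)) (fun ω : (Fin n → ZMod p) → Bool => ∏ i, w i (ω i))
    (fun ω => Finset.prod_nonneg fun i _ => hw _ _) (wE_one w h1)
    (fun j ω => match j with
      | none => (-1) * ((∑ x, ∏ i ∈ ({x} : Finset (Fin n → ZMod p)), w i true) / N) + t ≤
          (-1) * ((∑ x, indS ({x} : Finset (Fin n → ZMod p)) ω) / N)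
      | some d => 1 * ((∑ x, ∏ i ∈ S d x, w i true) / N) + t ≤
          1 * ((∑ x, indS (S d x) ω) / N))
    (fun _ => Real.exp (-y)) (by
      intro j
      cases j with
      | none =>
        have := indS_tail w hw h1 (fun x => {x}) (by
          intro i
          simp [Finset.filter_eq]) (-1) (by simp) t ht0.le ht1
          (Finset.univ.filter fun ω => (-1) * ((∑ x, ∏ i ∈ ({x} : Finset (Fin n → ZMod p)), w i true) / N) + t ≤
          (-1) * ((∑ x, indS ({x} : Finset (Fin n → ZMod p)) ω) / N)) (by
            intro ω hω
            rw [hcY]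
            exact (Finset.mem_filter.1 hω).2)
        rw [hcY] at this
        convert this
      | some d =>
        have := indS_tail w hw h1 (fun x => S d x) (by
          intro i
          refine le_trans (Finset.card_le_card ?_) (Finset.card_le_three (a := i) (b := i - d) (c := i - 2 • d))
          intro x hx
          simp only [S, Finset.mem_filter, Finset.mem_univ, true_and, Finset.mem_insert, Finset.mem_singleton] at hx ⊢
          rcases hx with h | h | h
          · exact Or.inl h.symm
          · exact Or.inr (Or.inl (by rw [h]; abel))
          · exact Or.inr (Or.inr (by rw [h]; abel))) 1 (by simp) t ht0.le ht1
          (Finset.univ.filter fun ω => 1 * ((∑ x, ∏ i ∈ S d x, w i true) / N) + t ≤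
          1 * ((∑ x, indS (S d x) ω) / N)) (by
            intro ω hω
            rw [hcY]
            exact (Finset.mem_filter.1 hω).2)
        rw [hcY] at this
        convert this) (by
      rw [Finset.sum_const, Finset.card_univ, Fintype.card_option, nsmul_eq_mul, Nat.cast_add, hcY]
      exact_mod_cast hbeta)
  refine ⟨Finset.univ.filter fun x => ω x = true, ?_, ?_⟩
  · have := hω none
    simp only [Finset.prod_singleton, indS, w, if_true, Finset.sum_boole] at this
    rw [← Finset.mul_sum, hF.sum, hcY, mul_div_assoc, div_self (by positivity), not_le] at this
    have h3 : α ≤ a - t := by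
      rw [had, htd]; nlinarith
    linarith
  · intro d hd
    have h2 := two_nsmul_ne hodd d hd
    have a2 : d ≠ 2 • d := by rw [two_nsmul]; simpa using hd
    have := hω (some d)
    have e1 : ∀ x (f : (Fin n → ZMod p) → ℝ), ∏ i ∈ S d x, f i = f x * f (x+d) * f (x + 2 • d) := by
      intro x f
      simp only [S]
      rw [Finset.prod_insert, Finset.prod_insert, Finset.prod_singleton, mul_assoc]
      · simpa using a2
      · simp only [Finset.mem_insert, Finset.mem_singleton, left_eq_add, not_or]
        exact ⟨hd, h2⟩
    simp only [e1, indS, w, if_true, not_le, one_mul] at this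
    have e2 : ∀ x, (if ω x = true then (1:ℝ) else 0) * (if ω (x+d) = true then 1 else 0) *
        (if ω (x+2•d) = true then 1 else 0) = if (ω x = true ∧ ω (x+d) = true ∧ ω (x+2•d) = true) then 1 else 0 := by
      intro x
      by_cases b1 : ω x = true <;> by_cases b2 : ω (x+d) = true <;> by_cases b3 : ω (x+2•d) = true <;> simp [b1, b2, b3]
    simp only [e2, Finset.sum_boole] at this
    have e3 : ∑ x, a * F x * (a * F (x+d)) * (a * F (x+2•d)) = a^3 * Lam F d := by
      rw [Lam, Finset.mul_sum]
      exact Finset.sum_congr rfl fun x _ => by ring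
    rw [e3] at this
    have hl := hF.lam d hd
    rw [hcY] at hl
    simp only [Finset.mem_filter, Finset.mem_univ, true_and]
    refine lt_of_lt_of_le this ?_
    have : a^3 * Lam F d / N ≤ a^3 * (1-δ) := by
      rw [div_le_iff₀ (by positivity), mul_assoc]
      exact mul_le_mul_of_nonneg_left hl (by positivity)
    have h4 : a^3 * (1-δ) ≤ α^3 * (1 - 3/4*δ) := by
      have : a^3 * (1-δ) = α^3 * ((1+δ/16)^3 * (1-δ)) := by rw [had]; ring
      rw [this]
      apply mul_le_mul_of_nonneg_left _ (by positivity)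
      have : (1 + δ/16)^3 ≤ 1 + δ/4 := by nlinarith [mul_pos hδ0 hδ0, mul_pos (mul_pos hδ0 hδ0) hδ0]
      nlinarith
    have h5 : 0 < α^3 * δ := by positivity
    have : t = α^3*δ/16 := htd
    nlinarith

end aux

theorem towerP_pos (p : ℕ) (hp : 0 < p) (k : ℕ) : 1 ≤ towerP p k := by
  cases k with
  | zero => exact le_refl _
  | succ k => exact Nat.pow_pos hp

theorem build (p : ℕ) [Fact p.Prime] (hodd : Odd p) (k : ℕ) :
    ∃ n n1 : ℕ, ∃ F : (Fin n → ZMod p) → ℝ, ∃ κ σ : ℝ, Good F κ σ (3/((p:ℝ)^n1)^2) ∧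
      (p:ℝ)^n1 ≤ (p:ℝ)^2 * 2^(42+11*k) ∧ (10:ℝ) ≤ (p:ℝ)^n1 ∧ 12 * towerP p k + 8 * n1 + 15 ≤ n := by
  have hp : p.Prime := Fact.out
  have hp1 := hp.one_lt
  have hp0 : (0:ℝ) < p := by exact_mod_cast hp.pos
  have hp1' : (1:ℝ) ≤ p := by exact_mod_cast hp.one_le
  set X := p * 2^(42+11*k) with hX
  set n1 := Nat.clog p X with hn1
  have hX1 : 1 < X := by
    rw [hX]
    have : 1 ≤ 2^(42+11*k) := Nat.one_le_two_pow
    nlinarith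
  have c1 : X ≤ p^n1 := Nat.le_pow_clog hp1 X
  have c2 : p^(n1-1) < X := Nat.pow_pred_clog_lt_self hp1 hX1
  have hn1' : 1 ≤ n1 := by
    by_contra h
    have : n1 = 0 := by omega
    rw [this] at c1; simp at c1; omega
  have c3 : p^n1 ≤ p^2 * 2^(42+11*k) := by
    calc p^n1 = p * p^(n1-1) := by rw [← pow_succ']; congr 1; omega
      _ ≤ p * X := Nat.mul_le_mul_left _ c2.le
      _ = _ := by rw [hX]; ring
  have c4 : n1 ≤ 43 + 11*k := by
    by_contra h
    have e : p^(n1-1) = p * p^(n1-2) := by rw [← pow_succ']; congr 1; omega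
    rw [e, hX] at c2
    have := lt_of_mul_lt_mul_left c2 (Nat.zero_le _)
    have h2 : 2^(42+11*k) ≤ p^(n1-2) :=
      le_trans (Nat.pow_le_pow_right (by norm_num) (by omega)) (Nat.pow_le_pow_left hp.two_le _)
    omega
  set W := 2^(k+10) with hW
  have hWb : 7 * n1 + 27 ≤ W := by
    have : k + 1 ≤ 2^k := Nat.lt_pow_self (by norm_num)
    rw [hW, pow_add]
    omega
  set σ : ℝ := (1/1024)^(k+2) with hσ
  have hσ0 : 0 < σ := by positivity
  have hσX : 2^12 * (W:ℝ) * p = σ * X := by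
    rw [hσ, hX, hW]
    push_cast
    have : (1024:ℝ) = 2^10 := by norm_num
    rw [this, one_div, inv_pow, ← pow_mul, eq_inv_mul_iff_mul_eq₀ (by positivity)]
    ring
  have c1' : (X:ℝ) ≤ (p:ℝ)^n1 := by exact_mod_cast c1
  have hXσ : 2^12 * (W:ℝ) * p ≤ σ * (p:ℝ)^n1 := by
    rw [hσX]; exact mul_le_mul_of_nonneg_left c1' hσ0.le
  have hW1 : (1:ℝ) ≤ W := by exact_mod_cast (by omega : 1 ≤ W)
  have hN : (10:ℝ) ≤ (p:ℝ)^n1 := by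
    refine le_trans ?_ c1'
    rw [hX]; push_cast
    have : (2:ℝ)^42 ≤ 2^(42+11*k) := pow_le_pow_right₀ (by norm_num) (by omega)
    nlinarith
  have hσN : 4 ≤ σ * (p:ℝ)^n1 := by nlinarith
  obtain ⟨F, κ, k1, k2, hF⟩ := base (n := n1) hodd σ hN hσN
  obtain ⟨F', hF'⟩ := iter hodd hn1' ⟨F, hF⟩ k1 k2 (by
      rw [div_le_iff₀ (by positivity)]; nlinarith) hσ0.le (k+1) (by
      intro i hi
      have : (1024:ℝ)^i ≤ 1024^k := pow_le_pow_right₀ (by norm_num) (by omega)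
      have e : (1024:ℝ)^k * σ = (1/1024)^2 := by
        rw [hσ, pow_add, ← mul_assoc, ← mul_pow]; norm_num
      have := mul_le_mul_of_nonneg_right this hσ0.le
      rw [e] at this
      linarith) (W := W) (by omega) hXσ (k+1) le_rfl
  refine ⟨_, n1, F', κ, _, hF', by exact_mod_cast c3, hN, ?_⟩
  have h1 := eSeq_ge (W := W) hp.one_le (by omega) k
  have h2 := towerP_pos p hp.pos k
  nlinarith [Nat.mul_le_mul_right (towerP p k) hWb, Nat.mul_le_mul_left (7*n1) h2]

/-- Lower bound for sets. Let `p` be an odd prime, `0 < α ≤ 1/2`,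
and `0 < ε ≤ 2⁻¹⁶¹ p⁻⁸ α³`. Then there exists `n` at least an exponential tower of
`p`'s of height `(1/52) log₂(α³/ε)` and a subset `A ⊆ 𝔽_p^n` of density at least `α`
such that for every nonzero `d ∈ 𝔽_p^n`, the density of 3-APs with common difference
`d` of `A` is less than `α³ - ε`. -/
theorem lower_bound_sets (p : ℕ) [Fact p.Prime] (hodd : Odd p) (α ε : ℝ)
    (hα0 : 0 < α) (hα : α ≤ 1 / 2) (hε0 : 0 < ε)
    (hε : ε ≤ (2 : ℝ) ^ (-161 : ℤ) * (p : ℝ) ^ (-8 : ℤ) * α ^ 3) :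
    ∃ n : ℕ, towerP p ⌊(1 / 52 : ℝ) * Real.logb 2 (α ^ 3 / ε)⌋₊ ≤ n ∧
      ∃ A : Finset (Fin n → ZMod p),
        α ≤ (A.card : ℝ) / (p : ℝ) ^ n ∧
        ∀ d : Fin n → ZMod p, d ≠ 0 →
          (((Finset.univ.filter fun x : Fin n → ZMod p =>
                x ∈ A ∧ x + d ∈ A ∧ x + 2 • d ∈ A).card : ℝ) / (p : ℝ) ^ n)
            < α ^ 3 - ε := by
  have hp : p.Prime := Fact.out
  have hp0 : (0:ℝ) < p := by exact_mod_cast hp.pos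
  have hp3 : (3:ℝ) ≤ p := by
    have h2 := hp.two_le
    have : p ≠ 2 := by rintro rfl; exact absurd hodd (by decide)
    exact_mod_cast (by omega : 3 ≤ p)
  set R := α^3 / ε with hR
  have hR0 : 0 < R := by positivity
  have hRε : R * ε = α^3 := by rw [hR]; field_simp
  have hRb : (2:ℝ)^161 * (p:ℝ)^8 ≤ R := by
    rw [hR, le_div_iff₀ hε0]
    have e : (2 : ℝ) ^ (-161 : ℤ) * (p : ℝ) ^ (-8 : ℤ) * α ^ 3 = α^3 / (2^161 * (p:ℝ)^8) := by
      rw [zpow_neg, zpow_neg]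
      have e1 : (2:ℝ)^(161:ℤ) = 2^161 := by norm_cast
      have e2 : (p:ℝ)^(8:ℤ) = (p:ℝ)^8 := by norm_cast
      rw [e1, e2, div_eq_mul_inv, mul_inv]; ring
    rw [e, le_div_iff₀ (by positivity)] at hε
    linarith
  have hp8 : (1:ℝ) ≤ (p:ℝ)^8 := one_le_pow₀ (by linarith)
  have hR161 : (2:ℝ)^161 ≤ R := by nlinarith
  set k := ⌊(1 / 52 : ℝ) * Real.logb 2 R⌋₊ with hk
  have hlog : (161:ℝ) ≤ Real.logb 2 R := by
    rw [Real.le_logb_iff_rpow_le (by norm_num) hR0]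
    exact_mod_cast hR161
  have hk1 : 1 ≤ k := by
    rw [hk]; apply Nat.le_floor; push_cast; linarith
  have hk2 : (2:ℝ)^(52*k) ≤ R := by
    have : (k:ℝ) ≤ (1 / 52 : ℝ) * Real.logb 2 R := Nat.floor_le (by linarith)
    have : ((52*k : ℕ):ℝ) ≤ Real.logb 2 R := by push_cast; linarith
    rw [Real.le_logb_iff_rpow_le (by norm_num) hR0, Real.rpow_natCast] at this
    exact this
  have hRgm : (2:ℝ)^(26*k+80) * (p:ℝ)^4 ≤ R := by
    refine (pow_le_pow_iff_left₀ (by positivity) hR0.le two_ne_zero).1 ?_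
    calc ((2:ℝ)^(26*k+80) * (p:ℝ)^4)^2 = 2^(52*k) * (2^160 * (p:ℝ)^8) := by
          rw [mul_pow, ← pow_mul, ← pow_mul, ← mul_assoc, ← pow_add]; congr 2; ring
      _ ≤ 2^(52*k) * (2^161 * (p:ℝ)^8) := by
          gcongr <;> norm_num
      _ ≤ R * R := mul_le_mul hk2 hRb (by positivity) hR0.le
      _ = R^2 := by ring
  have hα3 : 0 < α^3 := by positivity
  by_cases hc : α * (p:ℝ)^(towerP p k) ≤ 1
  · refine ⟨towerP p k, le_rfl, {0}, ?_, ?_⟩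
    · rw [le_div_iff₀ (by positivity)]; simpa using hc
    · intro d hd
      have : (Finset.univ.filter fun x : Fin (towerP p k) → ZMod p =>
                x ∈ ({0} : Finset (Fin (towerP p k) → ZMod p)) ∧ x + d ∈ ({0} : Finset (Fin (towerP p k) → ZMod p)) ∧ x + 2 • d ∈ ({0} : Finset (Fin (towerP p k) → ZMod p))) = ∅ := by
        rw [Finset.filter_eq_empty_iff]
        intro x _ hx
        simp only [Finset.mem_singleton] at hx
        obtain ⟨h1, h2, _⟩ := hx
        rw [h1, zero_add] at h2
        exact hd h2
      rw [this]
      have : 1 < R := by nlinarith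
      simp only [Finset.card_empty, Nat.cast_zero, zero_div]
      nlinarith
  · push Not at hc
    obtain ⟨n, n1, F, κ, σ, hF, b1, b2, b3⟩ := build p hodd k
    have hT : towerP p k ≤ n := by omega
    set M := (p:ℝ)^n1 with hM
    have hM0 : 0 < M := by linarith
    have hδ0 : 0 < 3 / M^2 := by positivity
    obtain ⟨A, hA1, hA2⟩ := sampling hodd hF α hα0 hα hδ0 (by
      rw [div_le_iff₀ (by positivity)]; nlinarith) (by
      set t := α^3 * (3/M^2) / 16 with ht
      have h1 : 1 ≤ t * (p:ℝ)^(3 * towerP p k + 2 * n1 + 2) := by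
        have e : t * (p:ℝ)^(3 * towerP p k + 2 * n1 + 2) = (α * (p:ℝ)^(towerP p k))^3 * (3 * (p:ℝ)^2 / 16) := by
          rw [ht, hM, pow_add, pow_add, pow_mul', pow_mul']
          field_simp
        rw [e]
        have : (1:ℝ) ≤ (α * (p:ℝ)^(towerP p k))^3 := one_le_pow₀ hc.le
        have h9 : (1:ℝ) ≤ 3 * (p:ℝ)^2/16 := by nlinarith
        exact one_le_mul_of_one_le_of_one_le this h9
      have h4 : 1 ≤ (t * (p:ℝ)^(3 * towerP p k + 2 * n1 + 2))^4 := one_le_pow₀ h1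
      have h7 : (1296:ℝ) ≤ (p:ℝ)^7 := by
        calc (1296:ℝ) ≤ 3^7 := by norm_num
          _ ≤ _ := pow_le_pow_left₀ (by norm_num) hp3 7
      have ht0 : 0 ≤ t := by positivity
      calc (1296:ℝ) ≤ (p:ℝ)^7 := h7
        _ ≤ (t * (p:ℝ)^(3 * towerP p k + 2 * n1 + 2))^4 * (p:ℝ)^7 := le_mul_of_one_le_left (by positivity) h4
        _ = t^4 * (p:ℝ)^(12 * towerP p k + 8 * n1 + 15) := by
          rw [mul_pow, ← pow_mul, mul_assoc, ← pow_add]; congr 2; ring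
        _ ≤ _ := by
          apply mul_le_mul_of_nonneg_left _ (by positivity)
          exact pow_le_pow_right₀ (by linarith) b3)
    refine ⟨n, hT, A, hA1, fun d hd => lt_of_lt_of_le (hA2 d hd) ?_⟩
    have h1 : M^2 ≤ (p:ℝ)^4 * 2^(26*k+80) := by
      calc M^2 ≤ ((p:ℝ)^2 * 2^(42+11*k))^2 := pow_le_pow_left₀ hM0.le b1 2
        _ = (p:ℝ)^4 * 2^(84+22*k) := by
          rw [mul_pow, ← pow_mul, ← pow_mul]; congr 2; ring
        _ ≤ _ := by
          apply mul_le_mul_of_nonneg_left _ (by positivity)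
          exact pow_le_pow_right₀ (by norm_num) (by omega)
    have h2 : M^2 ≤ R := by linarith
    have h3 : M^2 * ε ≤ α^3 := by rw [← hRε]; exact mul_le_mul_of_nonneg_right h2 hε0.le
    have h4 : ε ≤ α^3 / M^2 := by rw [le_div_iff₀ (by positivity)]; linarith
    have h5 : α^3 * (1 - 3/M^2/2) = α^3 - 3/2 * (α^3/M^2) := by ring
    rw [h5]
    have : 0 < α^3/M^2 := by positivity
    linarith
end

section
/- Choice of directions: Let p be an odd prime, I ⊆ 𝔽_p the interval of the residues of {0, 1, …, ⌈2p/3⌉ − 1}, ζ = ⌈2p/3⌉/p, and for b ∈ 𝔽_p let h(b) = (1/p)·|{x ∈ 𝔽_p : x ∈ I, x+b ∈ I, x+2b ∈ I}|. Let n', m be positive integers with m ≥ 3n' + 3, and let H ⊆ 𝔽_p^{n'} be a subset with |H| = ⌈10⁴·m·ln p⌉. Then there exists a function v : 𝔽_p^{n'} → 𝔽_p^m such that: (i) for every nonzero d ∈ 𝔽_p^m, 𝔼_{x ∈ H}[h(d · v(x))] ≤ ζ³ − 1/125; and (ii) for any three distinct a, b, c ∈ 𝔽_p^{n'}, the vectors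 v(a), v(b), v(c) are linearly independent over 𝔽_p. -/
/-- The interval `I ⊆ 𝔽_p` consisting of the residues of `0, 1, …, ⌈2p/3⌉ - 1`. -/
def intervalI (p : ℕ) : Finset (ZMod p) :=
  (Finset.range ⌈(2 * p : ℚ) / 3⌉₊).image fun k : ℕ => (k : ZMod p)

/-- `h(b)`: the density of 3-APs with common difference `b` in the interval
`intervalI p`, i.e. `(1/p) |{x ∈ 𝔽_p : x, x + b, x + 2b ∈ I}|`. -/
def hAP (p : ℕ) [NeZero p] (b : ZMod p) : ℚ :=
  ((Finset.univ.filter fun x : ZMod p =>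
      x ∈ intervalI p ∧ x + b ∈ intervalI p ∧ x + 2 • b ∈ intervalI p).card : ℚ) / p

open Finset in
lemma aux_hom {A B : Type*} [AddCommGroup A] [Fintype A] [AddCommGroup B] [Fintype B]
    (φ : A →+ B) (hφ : Function.Surjective φ) (F : B → ℝ) :
    (Fintype.card B : ℝ) * ∑ a, F (φ a) = Fintype.card A * ∑ b, F b := by
  have h1 : ∀ b : B, ∑ a, F (φ a + b) = ∑ a, F (φ a) := by
    intro b
    obtain ⟨c, rfl⟩ := hφ b
    rw [← Equiv.sum_comp (Equiv.addRight c) (fun a => F (φ a))]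
    simp
  have h2 : ∀ a : A, ∑ b, F (φ a + b) = ∑ b, F b := fun a =>
    Equiv.sum_comp (Equiv.addLeft (φ a)) F
  calc (Fintype.card B : ℝ) * ∑ a, F (φ a) = ∑ b : B, ∑ a, F (φ a + b) := by
        simp [h1]
    _ = ∑ a, ∑ b, F (φ a + b) := Finset.sum_comm
    _ = _ := by simp [h2]

lemma aux_exp (x : ℝ) (hx : |x| ≤ 1/10) : Real.exp x ≤ 1 + x + 0.6 * x^2 := by
  have h := Real.exp_bound (x := x) (by linarith) (n := 3) (by norm_num)
  simp [Finset.sum_range_succ, Nat.factorial] at h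
  have h' := (abs_le.mp h).2
  have : |x|^3 ≤ 1/10 * x^2 := by
    rw [pow_succ, sq_abs]; nlinarith [sq_nonneg x]
  nlinarith [sq_nonneg x]

lemma aux_parity (k : ℕ) : k ^ 2 ≤ 2 *
    ((Finset.range k ×ˢ Finset.range k).filter fun q => q.1 % 2 = q.2 % 2).card := by
  have key : (0:ℤ) ≤ ∑ q ∈ Finset.range k ×ˢ Finset.range k, ((-1)^q.1 * (-1)^q.2 : ℤ) := by
    rw [Finset.sum_product]
    rw [← Finset.sum_mul_sum]
    exact mul_self_nonneg _
  have e : ∀ q ∈ Finset.range k ×ˢ Finset.range k, ((-1)^q.1 * (-1)^q.2 : ℤ) =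
      2 * (if q.1 % 2 = q.2 % 2 then 1 else 0) - 1 := by
    intro q _
    rcases Nat.even_or_odd q.1 with h1 | h1 <;> rcases Nat.even_or_odd q.2 with h2 | h2 <;>
      rw [h1.neg_one_pow, h2.neg_one_pow] <;>
      simp [Nat.even_iff, Nat.odd_iff] at h1 h2 <;> simp [h1, h2]
  rw [Finset.sum_congr rfl e, Finset.sum_sub_distrib, ← Finset.mul_sum, Finset.sum_boole] at key
  simp at key
  have key' : k * k ≤ 2 * ((Finset.range k ×ˢ Finset.range k).filter
    fun q => q.1 % 2 = q.2 % 2).card := by exact_mod_cast key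
  rw [sq]; exact key'

lemma aux_k0 (p : ℕ) : 2 * p ≤ 3 * ⌈(2 * p : ℚ) / 3⌉₊ ∧ 3 * ⌈(2 * p : ℚ) / 3⌉₊ ≤ 2 * p + 2 := by
  have h1 := Nat.le_ceil ((2 * p : ℚ) / 3)
  have h2 := Nat.ceil_lt_add_one (a := (2 * p : ℚ) / 3) (by positivity)
  set c := ⌈(2 * p : ℚ) / 3⌉₊
  have a1 : (2 * p : ℚ) ≤ 3 * c := by linarith
  have a2 : (3 * c : ℚ) < 2 * p + 3 := by linarith
  have a1' : 2 * p ≤ 3 * c := by exact_mod_cast a1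
  have a2' : 3 * c < 2 * p + 3 := by exact_mod_cast a2
  omega

lemma aux_mem (p : ℕ) [Fact p.Prime] (x : ZMod p) (h3 : 3 ≤ p) :
    x ∈ intervalI p ↔ x.val < ⌈(2 * p : ℚ) / 3⌉₊ := by
  have hk := aux_k0 p
  unfold intervalI
  set c := ⌈(2 * p : ℚ) / 3⌉₊
  simp only [Finset.mem_image, Finset.mem_range]
  constructor
  · rintro ⟨a, ha, rfl⟩
    rw [ZMod.val_natCast, Nat.mod_eq_of_lt (by omega)]; exact ha
  · intro h
    exact ⟨x.val, h, ZMod.natCast_zmod_val x⟩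

lemma aux_cardI (p : ℕ) [Fact p.Prime] (h3 : 3 ≤ p) :
    (intervalI p).card = ⌈(2 * p : ℚ) / 3⌉₊ := by
  have hk := aux_k0 p
  unfold intervalI
  set c := ⌈(2 * p : ℚ) / 3⌉₊
  rw [Finset.card_image_of_injOn, Finset.card_range]
  intro a ha b hb hab
  simp at ha hb
  have := congrArg ZMod.val hab
  simpa [ZMod.val_natCast, Nat.mod_eq_of_lt (show a < p by omega),
    Nat.mod_eq_of_lt (show b < p by omega)] using this

/-- indicator of the complement -/
noncomputable def gJ (p : ℕ) (x : ZMod p) : ℝ := if x ∈ intervalI p then 0 else 1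

lemma aux_sumg (p : ℕ) [Fact p.Prime] (h3 : 3 ≤ p) :
    ∑ x, gJ p x = (p : ℝ) - ⌈(2 * p : ℚ) / 3⌉₊ := by
  have : ∀ x, gJ p x = 1 - (if x ∈ intervalI p then 1 else 0) := by
    intro x; unfold gJ; split_ifs <;> simp
  rw [Finset.sum_congr rfl (fun x _ => this x), Finset.sum_sub_distrib, Finset.sum_boole]
  simp [aux_cardI p h3]

lemma aux_h (p : ℕ) [Fact p.Prime] (b : ZMod p) :
    (p : ℝ) * (hAP p b : ℝ) = ∑ x, (1 - gJ p x) * (1 - gJ p (x + b)) * (1 - gJ p (x + 2 * b)) := by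
  have hp : (p : ℝ) ≠ 0 := by exact_mod_cast (Fact.out : p.Prime).ne_zero
  unfold hAP
  push_cast
  rw [mul_div_cancel₀ _ hp, ← Finset.sum_boole]
  refine Finset.sum_congr rfl fun x _ => ?_
  unfold gJ
  rw [nsmul_eq_mul]
  push_cast
  by_cases h1 : x ∈ intervalI p <;> by_cases h2 : x + b ∈ intervalI p <;>
    by_cases h3 : x + 2 * b ∈ intervalI p <;> simp [h1, h2, h3]

lemma aux_T (p : ℕ) [Fact p.Prime] (hodd : Odd p) (h3 : 3 ≤ p) :
    ∃ T : ℕ, (p - ⌈(2 * p : ℚ) / 3⌉₊) ^ 2 ≤ 2 * T ∧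
      (T : ℝ) ≤ ∑ b : ZMod p, ∑ x, gJ p x * gJ p (x + b) * gJ p (x + 2 * b) := by
  have hk := aux_k0 p
  have hmem := aux_mem p (h3 := h3)
  set c := ⌈(2 * p : ℚ) / 3⌉₊
  refine ⟨_, aux_parity (p - c), ?_⟩
  have h2 : (2 : ZMod p) ≠ 0 := by
    intro h
    have := (ZMod.natCast_eq_zero_iff 2 p).mp (by exact_mod_cast h)
    have := Nat.le_of_dvd (by norm_num) this
    omega
  have hg : ∀ n : ℕ, n < p - c → gJ p ((c + n : ℕ) : ZMod p) = 1 := by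
    intro n hn
    unfold gJ
    rw [if_neg]
    rw [hmem, ZMod.val_natCast, Nat.mod_eq_of_lt (by omega)]
    omega
  rw [← Finset.sum_product']
  have hnn : ∀ x, 0 ≤ gJ p x := by intro x; unfold gJ; split_ifs <;> norm_num
  set S := ((Finset.range (p-c) ×ˢ Finset.range (p-c)).filter fun q => q.1 % 2 = q.2 % 2)
  let f : ℕ × ℕ → ZMod p × ZMod p := fun q =>
    (((q.2 : ZMod p) - q.1) * 2⁻¹, ((c + q.1 : ℕ) : ZMod p))
  have hinj : Set.InjOn f S := by
    rintro ⟨a, b⟩ hab ⟨a', b'⟩ hab' h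
    simp [S] at hab hab'
    simp only [f, Prod.mk.injEq] at h
    obtain ⟨e1, e2⟩ := h
    have e3 := congrArg ZMod.val e2
    rw [ZMod.val_natCast, Nat.mod_eq_of_lt (by omega), ZMod.val_natCast,
      Nat.mod_eq_of_lt (by omega)] at e3
    have e4 : a = a' := by omega
    subst e4
    have e5 : (b : ZMod p) = b' := by
      have := mul_right_cancel₀ (inv_ne_zero h2) e1
      linear_combination this
    have e6 := congrArg ZMod.val e5
    rw [ZMod.val_natCast, Nat.mod_eq_of_lt (by omega), ZMod.val_natCast,
      Nat.mod_eq_of_lt (by omega)] at e6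
    rw [e6]
  rw [← Finset.card_image_of_injOn hinj]
  have hone : ∀ q ∈ S.image f, gJ p q.2 * gJ p (q.2 + q.1) * gJ p (q.2 + 2 * q.1) = 1 := by
    intro q hq
    obtain ⟨⟨a, b⟩, hab, rfl⟩ := Finset.mem_image.mp hq
    simp [S] at hab
    simp only [f]
    obtain ⟨r, hr⟩ : ∃ r, a + b = 2 * r := ⟨(a+b)/2, by omega⟩
    have hr' : (a : ZMod p) + b = 2 * r := by exact_mod_cast congrArg (Nat.cast (R := ZMod p)) hr
    have e1 : ((c + a : ℕ) : ZMod p) + ((b : ZMod p) - a) * 2⁻¹ = ((c + r : ℕ) : ZMod p) := by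
      push_cast
      field_simp
      linear_combination hr'
    have e2 : ((c + a : ℕ) : ZMod p) + 2 * (((b : ZMod p) - a) * 2⁻¹) = ((c + b : ℕ) : ZMod p) := by
      push_cast
      field_simp
      ring
    rw [e1, e2, hg _ (by omega), hg _ (by omega), hg _ (by omega)]; norm_num
  calc ((S.image f).card : ℝ) = ∑ q ∈ S.image f, gJ p q.2 * gJ p (q.2 + q.1) * gJ p (q.2 + 2 * q.1) := by
        rw [Finset.sum_congr rfl hone]; simp
    _ ≤ _ := Finset.sum_le_sum_of_subset_of_nonneg (by intro x _; simp)
        (fun q _ _ => mul_nonneg (mul_nonneg (hnn _) (hnn _)) (hnn _))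

set_option maxHeartbeats 1000000 in
lemma aux_mean (p : ℕ) [Fact p.Prime] (hodd : Odd p) (h3 : 3 ≤ p) :
    (∑ b : ZMod p, (hAP p b : ℝ)) ≤
      p * (((⌈(2 * p : ℚ) / 3⌉₊ : ℝ) / p) ^ 3 - 1 / 125 - 0.0089) := by
  obtain ⟨T, hT1, hT2⟩ := aux_T p hodd h3
  have hk := aux_k0 p
  have hs := aux_sumg p h3
  set c := ⌈(2 * p : ℚ) / 3⌉₊
  have h2 : (2 : ZMod p) ≠ 0 := by
    intro h
    have := (ZMod.natCast_eq_zero_iff 2 p).mp (by exact_mod_cast h)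
    have := Nat.le_of_dvd (by norm_num) this
    omega
  have hp : (0 : ℝ) < p := by exact_mod_cast (show 0 < p by omega)
  have s0 : ∀ x : ZMod p, ∑ b, gJ p (x + b) = ∑ b, gJ p b := fun x =>
    Equiv.sum_comp (Equiv.addLeft x) (gJ p)
  have s1 : ∀ x : ZMod p, ∑ b, gJ p (b + x) = ∑ b, gJ p b := fun x =>
    Equiv.sum_comp (Equiv.addRight x) (gJ p)
  have s2 : ∀ x : ZMod p, ∑ b, gJ p (x + 2 * b) = ∑ b, gJ p b := fun x => by
    rw [← s0 x]
    exact Equiv.sum_comp (Equiv.mulLeft₀ 2 h2) (fun b => gJ p (x + b))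
  set k : ℝ := (p : ℝ) - c with hkdef
  have t1 : ∑ b : ZMod p, ∑ x, gJ p x = p * k := by simp [hs]
  have t2 : ∑ b : ZMod p, ∑ x, gJ p (x + b) = p * k := by simp [hs, s1]
  have t3 : ∑ b : ZMod p, ∑ x, gJ p (x + 2 * b) = p * k := by simp [hs, s1]
  have t4 : ∑ b : ZMod p, ∑ x, gJ p x * gJ p (x + b) = k * k := by
    rw [Finset.sum_comm]; simp only [← Finset.mul_sum, s0, hs, ← Finset.sum_mul]
  have t5 : ∑ b : ZMod p, ∑ x, gJ p x * gJ p (x + 2 * b) = k * k := by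
    rw [Finset.sum_comm]; simp only [← Finset.mul_sum, s2, hs, ← Finset.sum_mul]
  have t6 : ∑ b : ZMod p, ∑ x, gJ p (x + b) * gJ p (x + 2 * b) = k * k := by
    rw [← t4]
    refine Finset.sum_congr rfl fun b _ => ?_
    rw [← Equiv.sum_comp (Equiv.addRight b) (fun x => gJ p x * gJ p (x + b))]
    refine Finset.sum_congr rfl fun x _ => ?_
    simp only [Equiv.coe_addRight]
    congr 2; ring
  have t0 : ∑ b : ZMod p, ∑ x : ZMod p, (1:ℝ) = p * p := by simp
  have main : p * (∑ b : ZMod p, (hAP p b : ℝ)) = p * p - 3 * p * k + 3 * k * k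
      - ∑ b : ZMod p, ∑ x, gJ p x * gJ p (x + b) * gJ p (x + 2 * b) := by
    rw [Finset.mul_sum, Finset.sum_congr rfl (fun b _ => aux_h p b)]
    have : ∀ b x : ZMod p, (1 - gJ p x) * (1 - gJ p (x + b)) * (1 - gJ p (x + 2 * b)) =
      1 - gJ p x - gJ p (x+b) - gJ p (x + 2 * b) + gJ p x * gJ p (x + b)
       + gJ p x * gJ p (x + 2 * b) + gJ p (x + b) * gJ p (x + 2 * b)
       - gJ p x * gJ p (x + b) * gJ p (x + 2 * b) := by intros; ring
    simp only [this, Finset.sum_sub_distrib, Finset.sum_add_distrib, t0, t1, t2, t3, t4, t5, t6]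
    ring
  have hcp : c ≤ p := by omega
  have hkn : ((p - c : ℕ) : ℝ) = k := by rw [Nat.cast_sub hcp]
  have fin : (0.0169 : ℝ) * p ^ 3 ≤ T * p - k ^ 3 := by
    have hT1' : k ^ 2 ≤ 2 * T := by rw [← hkn]; exact_mod_cast hT1
    have hk1 : 3 * (p - c) ≤ p := by omega
    have hk1' : 3 * k ≤ p := by rw [← hkn]; exact_mod_cast hk1
    by_cases h5 : p = 5
    · have hc : c = 4 := by omega
      have : k = 1 := by rw [hkdef, hc, h5]; norm_num
      rw [hc, h5] at hT1
      have hT : 1 ≤ T := by omega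
      have hT' : (1 : ℝ) ≤ T := by exact_mod_cast hT
      rw [this, h5]; norm_num; linarith
    · have h11 : 3 * p ≤ 11 * (p - c) := by
        obtain ⟨r, hr⟩ := hodd
        clear_value c
        by_cases h : 11 ≤ p
        · omega
        · have : r = 1 ∨ r = 3 ∨ r = 4 := by omega
          rcases this with rfl | rfl | rfl <;> omega
      have h11' : 3 * (p : ℝ) ≤ 11 * k := by rw [← hkn]; exact_mod_cast h11
      have hk0 : 0 ≤ k := by linarith
      have a1 : (0.0169 : ℝ) * p ^ 3 ≤ k ^ 2 / 2 * p - k ^ 3 := by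
        have hκ : ∃ z, k = z * p := ⟨k / p, by field_simp⟩
        obtain ⟨z, hz⟩ := hκ
        rw [hz] at h11' hk1' ⊢
        have z1 : 3 / 11 ≤ z := by
          by_contra! h
          nlinarith
        have z2 : z ≤ 1 / 3 := by
          by_contra! h
          nlinarith
        have : 0.0169 ≤ z ^ 2 / 2 - z ^ 3 := by
          nlinarith [mul_nonneg (sub_nonneg.2 z1) (sub_nonneg.2 z2),
            mul_nonneg (mul_nonneg (sub_nonneg.2 z1) (sub_nonneg.2 z2)) (by linarith : 0 ≤ z)]
        have p3 : (0:ℝ) < p ^ 3 := by positivity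
        nlinarith
      nlinarith
  have hc' : (c : ℝ) = p - k := by rw [hkdef]; ring
  rw [hc']
  have e : (p : ℝ) * (((p - k) / p) ^ 3 - 1 / 125 - 0.0089) =
    ((p - k) ^ 3 - 0.0169 * p ^ 3) / p ^ 2 := by
    field_simp; ring
  rw [e, le_div_iff₀ (by positivity)]
  nlinarith

lemma aux_hle (p : ℕ) [Fact p.Prime] (hodd : Odd p) (h3 : 3 ≤ p) (b : ZMod p) :
    0 ≤ (hAP p b : ℝ) ∧ (hAP p b : ℝ) ≤ 4 / 5 := by
  have hk := aux_k0 p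
  have hc := aux_cardI p h3
  set c := ⌈(2 * p : ℚ) / 3⌉₊
  have hp : (0 : ℝ) < p := by exact_mod_cast (show 0 < p by omega)
  unfold hAP
  push_cast
  constructor
  · positivity
  · rw [div_le_iff₀ hp]
    have h1 : (Finset.univ.filter fun x : ZMod p =>
      x ∈ intervalI p ∧ x + b ∈ intervalI p ∧ x + 2 • b ∈ intervalI p).card ≤ c := by
      rw [← hc]
      apply Finset.card_le_card
      intro x hx
      simp at hx
      exact hx.1
    have h2 : 5 * c ≤ 4 * p := by
      by_cases h : 5 ≤ p
      · omega
      · have : p = 3 ∨ p = 4 := by omega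
        rcases this with h | h
        · have : c ≤ 2 := by omega
          omega
        · rw [h] at hodd; exact absurd hodd (by decide)
    have h1' : ((Finset.univ.filter fun x : ZMod p =>
      x ∈ intervalI p ∧ x + b ∈ intervalI p ∧ x + 2 • b ∈ intervalI p).card : ℝ) ≤ c := by
      exact_mod_cast h1
    have h2' : 5 * (c : ℝ) ≤ 4 * p := by exact_mod_cast h2
    linarith

lemma aux_mgf (p : ℕ) [Fact p.Prime] (hodd : Odd p) (h3 : 3 ≤ p) (τ : ℝ)
    (hτ : τ = ((⌈(2 * p : ℚ) / 3⌉₊ : ℝ) / p) ^ 3 - 1 / 125) :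
    ∑ b : ZMod p, Real.exp (((hAP p b : ℝ) - τ) / 20) ≤ p * Real.exp (-(2 / 10 ^ 4)) := by
  have hm := aux_mean p hodd h3
  rw [← hτ] at hm
  have hh := aux_hle p hodd h3
  have hp : (0 : ℝ) < p := by exact_mod_cast (show 0 < p by omega)
  obtain ⟨μ, hμ⟩ : ∃ μ : ℝ, ∑ b : ZMod p, (hAP p b : ℝ) = p * μ :=
    ⟨(∑ b : ZMod p, (hAP p b : ℝ)) / p, by field_simp⟩
  have hcard : (Finset.univ : Finset (ZMod p)).card = p := by simp
  have hμ0 : 0 ≤ μ := by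
    have : 0 ≤ ∑ b : ZMod p, (hAP p b : ℝ) := Finset.sum_nonneg fun b _ => (hh b).1
    by_contra! h
    nlinarith
  have hμ1 : μ ≤ 4 / 5 := by
    have : ∑ b : ZMod p, (hAP p b : ℝ) ≤ ∑ b : ZMod p, (4 / 5 : ℝ) :=
      Finset.sum_le_sum fun b _ => (hh b).2
    rw [hμ] at this
    simp at this
    by_contra! h
    nlinarith
  have ht : μ ≤ τ - 0.0089 := by
    rw [hμ] at hm
    exact le_of_mul_le_mul_left hm hp
  have hb : ∀ b : ZMod p, Real.exp (((hAP p b : ℝ) - μ) / 20) ≤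
      1 + ((hAP p b : ℝ) - μ) / 20 +
        0.6 / 400 * (4 / 5 * (hAP p b : ℝ) - 2 * μ * (hAP p b : ℝ) + μ ^ 2) := by
    intro b
    obtain ⟨h0, h1⟩ := hh b
    have := aux_exp (((hAP p b : ℝ) - μ) / 20) (by rw [abs_le]; constructor <;> linarith)
    nlinarith
  have hsum : ∑ b : ZMod p, Real.exp (((hAP p b : ℝ) - μ) / 20) ≤ p * (1 + 0.00024) := by
    refine (Finset.sum_le_sum fun b _ => hb b).trans ?_
    simp only [Finset.sum_add_distrib, ← Finset.sum_div, ← Finset.mul_sum, Finset.sum_sub_distrib,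
      hμ, Finset.sum_const, hcard, nsmul_eq_mul]
    have : 4 / 5 * μ - μ ^ 2 ≤ 0.16 := by nlinarith [sq_nonneg (μ - 2 / 5)]
    nlinarith
  calc ∑ b : ZMod p, Real.exp (((hAP p b : ℝ) - τ) / 20)
      = (∑ b : ZMod p, Real.exp (((hAP p b : ℝ) - μ) / 20)) * Real.exp ((μ - τ) / 20) := by
        rw [Finset.sum_mul]
        refine Finset.sum_congr rfl fun b _ => ?_
        rw [← Real.exp_add]; congr 1; ring
    _ ≤ (p * Real.exp 0.00024) * Real.exp (-0.000445) := by
        gcongr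
        · refine hsum.trans ?_
          gcongr
          have := Real.add_one_le_exp (0.00024 : ℝ)
          linarith
        · linarith
    _ ≤ _ := by
        rw [mul_assoc, ← Real.exp_add]
        gcongr
        norm_num

lemma aux_prod {K V : Type*} [Fintype K] [DecidableEq K] [Fintype V] (H : Finset K)
    (g : V → ℝ) (hg : ∀ y, 0 ≤ g y) (ρ : ℝ) (h : ∑ y, g y ≤ Fintype.card V * ρ) :
    ∑ v : K → V, ∏ x ∈ H, g (v x) ≤ Fintype.card (K → V) * ρ ^ H.card := by
  classical
  have e1 : ∀ v : K → V, ∏ x ∈ H, g (v x) = ∏ x, (if x ∈ H then g (v x) else 1) := by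
    intro v
    rw [Finset.prod_ite_mem]; simp
  simp only [e1]
  rw [← Fintype.piFinset_univ, ← Finset.prod_univ_sum (fun _ => (Finset.univ : Finset V))
    (fun x y => if x ∈ H then g y else 1)]
  calc _ ≤ ∏ x : K, ((Fintype.card V : ℝ) * (if x ∈ H then ρ else 1)) := by
        apply Finset.prod_le_prod
        · intro x _
          apply Finset.sum_nonneg
          intro y _
          split_ifs
          · exact hg y
          · norm_num
        · intro x _
          split_ifs
          · exact h
          · simp
    _ = _ := by
        rw [Finset.prod_mul_distrib, Finset.prod_ite_mem]
        simp

/-- Choice of directions. Let `p` be an odd prime, `I ⊆ 𝔽_p` the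
interval of the residues of `{0, 1, …, ⌈2p/3⌉ - 1}`, `ζ = ⌈2p/3⌉/p`, and for
`b ∈ 𝔽_p` let `h(b)` be the density of 3-APs in `I` with common difference `b`.
Let `n', m` be positive integers with `m ≥ 3n' + 3` and `H ⊆ 𝔽_p^{n'}` with
`|H| = ⌈10⁴ m ln p⌉`. Then there is `v : 𝔽_p^{n'} → 𝔽_p^m` such that (i) for every
nonzero `d ∈ 𝔽_p^m`, `𝔼_{x ∈ H}[h(d · v(x))] ≤ ζ³ - 1/125`, and (ii) for any three
distinct `a, b, c ∈ 𝔽_p^{n'}`, the vectors `v(a), v(b), v(c)` are linearly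
independent over `𝔽_p`. -/
theorem choice_of_directions (p : ℕ) [Fact p.Prime] (hodd : Odd p) (n' m : ℕ)
    (hn' : 0 < n') (hm : 0 < m) (hmn : 3 * n' + 3 ≤ m)
    (H : Finset (Fin n' → ZMod p))
    (hH : H.card = ⌈(10 ^ 4 : ℝ) * m * Real.log p⌉₊) :
    ∃ v : (Fin n' → ZMod p) → (Fin m → ZMod p),
      (∀ d : Fin m → ZMod p, d ≠ 0 →
        ((∑ x ∈ H, (hAP p (∑ i, d i * v x i) : ℝ)) / H.card : ℝ) ≤
          ((⌈(2 * p : ℚ) / 3⌉₊ : ℝ) / p) ^ 3 - 1 / 125) ∧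
      (∀ a b c : Fin n' → ZMod p, a ≠ b → a ≠ c → b ≠ c →
        LinearIndependent (ZMod p) ![v a, v b, v c]) := by
  classical
  have h3 : 3 ≤ p := by
    have := (Fact.out : p.Prime).two_le
    obtain ⟨r, hr⟩ := hodd
    omega
  have hp : (0 : ℝ) < p := by exact_mod_cast (show 0 < p by omega)
  obtain ⟨τ, hτ⟩ : ∃ τ : ℝ, τ = ((⌈(2 * p : ℚ) / 3⌉₊ : ℝ) / p) ^ 3 - 1 / 125 := ⟨_, rfl⟩
  have hmgf := aux_mgf p hodd h3 τ hτ
  rw [← hτ]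
  have hlog : 0 < Real.log p := Real.log_pos (by exact_mod_cast (show 1 < p by omega))
  have hN : (10 ^ 4 : ℝ) * m * Real.log p ≤ H.card := by rw [hH]; exact Nat.le_ceil _
  have hm' : (0 : ℝ) < m := by exact_mod_cast hm
  have hNpos : (0 : ℝ) < H.card := lt_of_lt_of_le (by positivity) hN
  have hcV : (Fintype.card (Fin m → ZMod p) : ℝ) = (p : ℝ) ^ m := by simp
  obtain ⟨Ω, hΩ⟩ : ∃ Ω : ℝ, Ω = Fintype.card ((Fin n' → ZMod p) → (Fin m → ZMod p)) := ⟨_, rfl⟩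
  have hΩpos : 0 < Ω := by rw [hΩ]; exact_mod_cast Fintype.card_pos
  -- first family of events
  let E : (Fin m → ZMod p) → ((Fin n' → ZMod p) → (Fin m → ZMod p)) → ℝ := fun d v =>
    ∏ x ∈ H, Real.exp (((hAP p (∑ i, d i * v x i) : ℝ) - τ) / 20)
  have hE0 : ∀ d v, 0 ≤ E d v := fun d v => Finset.prod_nonneg fun x _ => (Real.exp_pos _).le
  have hE : ∀ d, d ≠ 0 → (p : ℝ) ^ (2 * m) * ∑ v, E d v ≤ Ω := by
    intro d hd
    obtain ⟨j, hj⟩ := Function.ne_iff.mp hd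
    let φ : (Fin m → ZMod p) →+ ZMod p :=
      { toFun := fun y => ∑ i, d i * y i
        map_zero' := by simp
        map_add' := by intro a b; simp [mul_add, Finset.sum_add_distrib] }
    have hφ : Function.Surjective φ := by
      intro u
      refine ⟨Pi.single j ((d j)⁻¹ * u), ?_⟩
      change ∑ i, d i * (Pi.single j ((d j)⁻¹ * u) : Fin m → ZMod p) i = u
      rw [Finset.sum_eq_single j]
      · rw [Pi.single_eq_same, mul_inv_cancel_left₀ hj]
      · intro b _ hb; simp [Pi.single_eq_of_ne hb]
      · simp
    have key := aux_hom φ hφ (fun b => Real.exp (((hAP p b : ℝ) - τ) / 20))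
    rw [ZMod.card] at key
    have hsum : ∑ y : Fin m → ZMod p, Real.exp (((hAP p (∑ i, d i * y i) : ℝ) - τ) / 20) ≤
        Fintype.card (Fin m → ZMod p) * Real.exp (-(2 / 10 ^ 4)) := by
      have : (p : ℝ) * ∑ y : Fin m → ZMod p, Real.exp (((hAP p (φ y) : ℝ) - τ) / 20) ≤
        p * (Fintype.card (Fin m → ZMod p) * Real.exp (-(2 / 10 ^ 4))) := by
        rw [key, mul_left_comm]
        gcongr
      exact le_of_mul_le_mul_left this hp
    have h1 := aux_prod H (fun y : Fin m → ZMod p =>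
      Real.exp (((hAP p (∑ i, d i * y i) : ℝ) - τ) / 20)) (fun y => (Real.exp_pos _).le) _ hsum
    rw [← hΩ, ← Real.exp_nat_mul] at h1
    have h2 : Real.exp (H.card * (-(2 / 10 ^ 4))) ≤ ((p : ℝ) ^ (2 * m))⁻¹ := by
      rw [← Real.exp_log (show 0 < ((p : ℝ) ^ (2 * m))⁻¹ by positivity)]
      rw [Real.exp_le_exp, Real.log_inv, Real.log_pow]
      push_cast
      linarith
    calc (p : ℝ) ^ (2 * m) * ∑ v, E d v ≤ (p : ℝ) ^ (2 * m) * (Ω * ((p : ℝ) ^ (2 * m))⁻¹) := by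
          gcongr
          exact h1.trans (by gcongr)
      _ = Ω := by field_simp
  -- second family of events
  let F : (Fin 3 → (Fin n' → ZMod p)) → (Fin 3 → ZMod p) →
      ((Fin n' → ZMod p) → (Fin m → ZMod p)) → ℝ := fun w c v =>
    if ∑ i, c i • v (w i) = 0 then 1 else 0
  have hF0 : ∀ w c v, 0 ≤ F w c v := by
    intro w c v; simp only [F]; split_ifs <;> norm_num
  have hF : ∀ w c, Function.Injective w → c ≠ 0 → (p : ℝ) ^ m * ∑ v, F w c v = Ω := by
    intro w c hw hc
    obtain ⟨j, hj⟩ := Function.ne_iff.mp hc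
    let φ : ((Fin n' → ZMod p) → (Fin m → ZMod p)) →+ (Fin m → ZMod p) :=
      { toFun := fun v => ∑ i, c i • v (w i)
        map_zero' := by simp
        map_add' := by intro a b; simp [smul_add, Finset.sum_add_distrib] }
    have hφ : Function.Surjective φ := by
      intro u
      refine ⟨Pi.single (w j) ((c j)⁻¹ • u), ?_⟩
      change ∑ i, c i • (Pi.single (w j) ((c j)⁻¹ • u) :
        (Fin n' → ZMod p) → (Fin m → ZMod p)) (w i) = u
      rw [Finset.sum_eq_single j]
      · rw [Pi.single_eq_same, smul_inv_smul₀ hj]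
      · intro b _ hb; rw [Pi.single_eq_of_ne (hw.ne hb), smul_zero]
      · simp
    have key := aux_hom φ hφ (fun u => if u = 0 then 1 else 0)
    rw [hcV, ← hΩ] at key
    have e : ∑ u : Fin m → ZMod p, (if u = 0 then (1:ℝ) else 0) = 1 := by simp
    rw [e, mul_one] at key
    exact key
  by_contra! hcon
  let D := (Finset.univ : Finset (Fin m → ZMod p)).filter (· ≠ 0)
  let W := (Finset.univ : Finset (Fin 3 → (Fin n' → ZMod p))).filter Function.Injective
  let C := (Finset.univ : Finset (Fin 3 → ZMod p)).erase 0
  have hone : ∀ v, 1 ≤ ∑ d ∈ D, E d v + ∑ w ∈ W, ∑ c ∈ C, F w c v := by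
    intro v
    have hA : 0 ≤ ∑ d ∈ D, E d v := Finset.sum_nonneg fun d _ => hE0 d v
    have hB : 0 ≤ ∑ w ∈ W, ∑ c ∈ C, F w c v :=
      Finset.sum_nonneg fun w _ => Finset.sum_nonneg fun c _ => hF0 w c v
    by_cases hv : ∀ d : Fin m → ZMod p, d ≠ 0 →
        ((∑ x ∈ H, (hAP p (∑ i, d i * v x i) : ℝ)) / H.card : ℝ) ≤ τ
    · obtain ⟨a, b, c, hab, hac, hbc, hl⟩ := hcon v hv
      rw [Fintype.not_linearIndependent_iff] at hl
      obtain ⟨g, hg, j, hj⟩ := hl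
      have hw : ![a, b, c] ∈ W := by
        simp only [W, Finset.mem_filter, Finset.mem_univ, true_and]
        intro i k
        fin_cases i <;> fin_cases k <;> simp [hab, hac, hbc, hab.symm, hac.symm, hbc.symm]
      have hgC : g ∈ C := by
        simp only [C, Finset.mem_erase, Finset.mem_univ, and_true]
        rintro rfl
        exact hj rfl
      have h1 : F ![a, b, c] g v = 1 := by
        simp only [F]
        rw [if_pos]
        rw [← hg]
        simp [Fin.sum_univ_three]
      have h3 : F ![a, b, c] g v ≤ ∑ e ∈ C, F ![a, b, c] e v :=
        Finset.single_le_sum (f := fun e => F ![a, b, c] e v) (fun e _ => hF0 _ _ v) hgC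
      have h4 : ∑ e ∈ C, F ![a, b, c] e v ≤ ∑ w ∈ W, ∑ e ∈ C, F w e v :=
        Finset.single_le_sum (f := fun w => ∑ e ∈ C, F w e v)
          (fun w _ => Finset.sum_nonneg fun e _ => hF0 _ _ v) hw
      linarith
    · push Not at hv
      obtain ⟨d, hd, hlt⟩ := hv
      have h1 : 1 ≤ E d v := by
        simp only [E]
        rw [← Real.exp_sum, Real.one_le_exp_iff, ← Finset.sum_div, Finset.sum_sub_distrib]
        rw [lt_div_iff₀ hNpos] at hlt
        simp only [Finset.sum_const, nsmul_eq_mul]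
        apply div_nonneg _ (by norm_num)
        linarith
      have h2 : E d v ≤ ∑ d ∈ D, E d v :=
        Finset.single_le_sum (f := fun d => E d v) (fun d _ => hE0 d v) (by simp [D, hd])
      linarith
  have htot : Ω ≤ ∑ d ∈ D, ∑ v, E d v + ∑ w ∈ W, ∑ c ∈ C, ∑ v, F w c v := by
    have := Finset.sum_le_sum fun v (_ : v ∈ Finset.univ) => hone v
    rw [Finset.sum_add_distrib, Finset.sum_comm] at this
    have e : ∑ v, ∑ w ∈ W, ∑ c ∈ C, F w c v = ∑ w ∈ W, ∑ c ∈ C, ∑ v, F w c v := by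
      rw [Finset.sum_comm]
      refine Finset.sum_congr rfl fun w _ => ?_
      rw [Finset.sum_comm]
    rw [e] at this
    simpa [hΩ] using this
  have hpm : (0 : ℝ) < (p : ℝ) ^ m := by positivity
  have hD : (p : ℝ) ^ m * ∑ d ∈ D, ∑ v, E d v ≤ Ω := by
    have h1 : (p : ℝ) ^ (2 * m) * ∑ d ∈ D, ∑ v, E d v ≤ p ^ m * Ω := by
      rw [Finset.mul_sum]
      calc _ ≤ ∑ d ∈ D, Ω := Finset.sum_le_sum fun d hd => hE d (by simpa [D] using hd)
        _ = D.card * Ω := by simp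
        _ ≤ _ := by
          gcongr
          rw [← hcV]
          exact_mod_cast Finset.card_le_univ D
    rw [two_mul, pow_add, mul_assoc] at h1
    exact le_of_mul_le_mul_left h1 hpm
  have hWC : (p : ℝ) ^ m * ∑ w ∈ W, ∑ c ∈ C, ∑ v, F w c v ≤ p ^ (3 * n') * ((p ^ 3 - 1) * Ω) := by
    have hCc : (C.card : ℝ) = p ^ 3 - 1 := by
      simp only [C]
      rw [Finset.card_erase_of_mem (Finset.mem_univ _), Finset.card_univ]
      rw [Nat.cast_sub Fintype.card_pos]
      simp
    have hWc : (W.card : ℝ) ≤ p ^ (3 * n') := by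
      have : W.card ≤ p ^ (3 * n') := by
        refine (Finset.card_le_univ W).trans ?_
        simp [← pow_mul, mul_comm]
      exact_mod_cast this
    rw [Finset.mul_sum]
    calc _ = ∑ w ∈ W, ∑ c ∈ C, Ω := by
          refine Finset.sum_congr rfl fun w hw => ?_
          rw [Finset.mul_sum]
          refine Finset.sum_congr rfl fun c hc => ?_
          exact hF w c (by simpa [W] using hw) (by simpa [C] using hc)
      _ = W.card * (C.card * Ω) := by simp
      _ ≤ _ := by
        rw [hCc]
        have : (0 : ℝ) ≤ p ^ 3 - 1 := by rw [← hCc]; positivity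
        gcongr
  have h1 : (p : ℝ) ^ m * Ω ≤ Ω + p ^ (3 * n') * ((p ^ 3 - 1) * Ω) := by
    have := mul_le_mul_of_nonneg_left htot hpm.le
    rw [mul_add] at this
    linarith
  have h2 : (p : ℝ) ^ m ≤ 1 + p ^ (3 * n') * (p ^ 3 - 1) := by
    refine le_of_mul_le_mul_right ?_ hΩpos
    linarith
  have hp1 : (1 : ℝ) < p := by exact_mod_cast (show 1 < p by omega)
  have h4 : (p : ℝ) ^ (3 * n' + 3) ≤ p ^ m := pow_le_pow_right₀ hp1.le hmn
  have h5 : (1 : ℝ) < p ^ (3 * n') := one_lt_pow₀ hp1 (by omega)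
  rw [pow_add] at h4
  linarith
end

section
/- Stability lemma: Let p be an odd prime, n', m positive integers, f' : 𝔽_p^{n'} → [0,1], H ⊆ 𝔽_p^{n'}, I ⊆ 𝔽_p nonempty with ζ = |I|/p, and v : 𝔽_p^{n'} → 𝔽_p^m a function such that for any three distinct a, b, c ∈ 𝔽_p^{n'}, the vectors v(a), v(b), v(c) are linearly independent over 𝔽_p. Define f : 𝔽_p^{n'} × 𝔽_p^m → ℝ by f(x, y) = f'(x) if x ∉ H; f(x, y) = (1/ζ)·f'(x) if x ∈ H and y · v(x) ∈ I; and f(x, y) = 0 if x ∈ H and y · v(x) ∉ I. Then for every d = (d*, d') ∈ 𝔽_p^{n'} × 𝔽_p^m with d* ≠ 0, the density of 3-APs of f with common difference d equals the density of 3-APs of f' with common difference d*: 𝔼_{(x,y)}[f(x,y)·f((x,y)+d)·f((x,y)+2d)] = 𝔼_{x}[f'(x)·f'(x+d*)·f'(x+2d*)]. -/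
lemma key_equidist (p : ℕ) [Fact p.Prime] (m : ℕ) (u : Fin 3 → Fin m → ZMod p)
    (hu : LinearIndependent (ZMod p) u) (g : Fin 3 → ZMod p → ℝ) (c : Fin 3 → ZMod p) :
    (p : ℝ) ^ 3 * ∑ y : Fin m → ZMod p, ∏ i, g i ((∑ j, y j * u i j) + c i) =
      (p : ℝ) ^ m * ∏ i, ∑ t, g i t := by
  classical
  set L := Matrix.mulVecLin (Matrix.of u) with hL
  have hsurj : Function.Surjective L := by
    rw [← LinearMap.range_eq_top]
    apply Submodule.eq_top_of_finrank_eq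
    have h1 : (Matrix.of u).rank = Fintype.card (Fin 3) := LinearIndependent.rank_matrix hu
    rw [Matrix.rank] at h1
    rw [h1]; simp
  have hLa : ∀ y i, (∑ j, y j * u i j) = L y i := by
    intro y i
    simp [hL, Matrix.mulVec, dotProduct, mul_comm]
  simp_rw [hLa]
  have h1 : ∀ t : Fin 3 → ZMod p, ∑ y : Fin m → ZMod p, ∏ i, g i (L y i + c i) =
      ∑ y : Fin m → ZMod p, ∏ i, g i (L y i + t i + c i) := by
    intro t
    obtain ⟨s, hs⟩ := hsurj t
    rw [← Equiv.sum_comp (Equiv.addRight s)]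
    simp [hs]
  have h2 : ∑ _t : Fin 3 → ZMod p, ∑ y : Fin m → ZMod p, ∏ i, g i (L y i + c i) =
      ∑ t : Fin 3 → ZMod p, ∑ y : Fin m → ZMod p, ∏ i, g i (L y i + t i + c i) :=
    Finset.sum_congr rfl (fun t _ => h1 t)
  rw [Finset.sum_comm (s := Finset.univ (α := Fin 3 → ZMod p))
    (f := fun t y => ∏ i, g i (L y i + t i + c i))] at h2
  have h3 : ∀ y : Fin m → ZMod p, ∑ t : Fin 3 → ZMod p, ∏ i, g i (L y i + t i + c i) =
      ∏ i, ∑ t, g i t := by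
    intro y
    rw [Finset.prod_univ_sum, Fintype.piFinset_univ,
      ← Equiv.sum_comp (Equiv.addRight (L y + c)) (fun t => ∏ i, g i (t i))]
    refine Finset.sum_congr rfl fun t _ => Finset.prod_congr rfl fun i _ => ?_
    simp only [Equiv.coe_addRight, Pi.add_apply]
    congr 1; ring
  simp_rw [h3] at h2
  simpa [ZMod.card] using h2

/-- Stability lemma. Let `p` be an odd prime, `n', m` positive
integers, `f' : 𝔽_p^{n'} → [0,1]`, `H ⊆ 𝔽_p^{n'}`, `I ⊆ 𝔽_p` nonempty with
`ζ = |I|/p`, and `v : 𝔽_p^{n'} → 𝔽_p^m` such that for any three distinct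
`a, b, c ∈ 𝔽_p^{n'}` the vectors `v(a), v(b), v(c)` are linearly independent. Define
`f(x, y) = f'(x)` if `x ∉ H`; `f(x, y) = (1/ζ) f'(x)` if `x ∈ H` and `y · v(x) ∈ I`;
and `f(x, y) = 0` if `x ∈ H` and `y · v(x) ∉ I`. Then for every
`d = (d*, d') ∈ 𝔽_p^{n'} × 𝔽_p^m` with `d* ≠ 0`, the density of 3-APs of `f` with
common difference `d` equals the density of 3-APs of `f'` with common difference
`d*`. -/
theorem stability_lemma (p : ℕ) [Fact p.Prime] (hodd : Odd p) (n' m : ℕ)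
    (hn' : 0 < n') (hm : 0 < m) (f' : (Fin n' → ZMod p) → ℝ)
    (hf' : ∀ x, f' x ∈ Set.Icc (0 : ℝ) 1)
    (H : Finset (Fin n' → ZMod p)) (I : Finset (ZMod p)) (hI : I.Nonempty)
    (ζ : ℝ) (hζ : ζ = (I.card : ℝ) / p)
    (v : (Fin n' → ZMod p) → (Fin m → ZMod p))
    (hv : ∀ a b c : Fin n' → ZMod p, a ≠ b → a ≠ c → b ≠ c →
      LinearIndependent (ZMod p) ![v a, v b, v c])
    (f : (Fin n' → ZMod p) × (Fin m → ZMod p) → ℝ)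
    (hf : ∀ x y, f (x, y) =
      if x ∈ H then (if (∑ i, y i * v x i) ∈ I then (1 / ζ) * f' x else 0) else f' x)
    (dstar : Fin n' → ZMod p) (hd : dstar ≠ 0) (d' : Fin m → ZMod p) :
    (∑ x : Fin n' → ZMod p, ∑ y : Fin m → ZMod p,
        f (x, y) * f (x + dstar, y + d') * f (x + 2 • dstar, y + 2 • d')) /
        ((p : ℝ) ^ n' * (p : ℝ) ^ m) =
      (∑ x : Fin n' → ZMod p, f' x * f' (x + dstar) * f' (x + 2 • dstar)) /
        (p : ℝ) ^ n' := by
  classical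
  have hp : (p : ℝ) ≠ 0 := by exact_mod_cast (Fact.out : p.Prime).ne_zero
  have hIc : (I.card : ℝ) ≠ 0 := by exact_mod_cast hI.card_pos.ne'
  let G : (Fin n' → ZMod p) → ZMod p → ℝ := fun x t =>
    if x ∈ H then (if t ∈ I then (1 / ζ) * f' x else 0) else f' x
  have hG : ∀ x, ∑ t, G x t = p * f' x := by
    intro x
    by_cases hx : x ∈ H
    · simp only [G, hx, if_true, ← Finset.sum_filter, Finset.filter_univ_mem,
        Finset.sum_const, nsmul_eq_mul, hζ]
      field_simp
    · simp [G, hx, ZMod.card]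
  have h2 : (2 : ZMod p) ≠ 0 := by
    intro h
    have h' : ((2 : ℕ) : ZMod p) = 0 := by exact_mod_cast h
    rw [ZMod.natCast_eq_zero_iff] at h'
    have := (Nat.prime_dvd_prime_iff_eq Fact.out Nat.prime_two).1 h'
    subst this
    exact absurd hodd (by decide)
  have h2d : 2 • dstar ≠ 0 := by
    intro h
    apply hd
    funext i
    have := congrFun h i
    simpa [h2] using this
  have hx : ∀ x, ∑ y : Fin m → ZMod p,
      f (x, y) * f (x + dstar, y + d') * f (x + 2 • dstar, y + 2 • d') =
      (p : ℝ) ^ m * (f' x * f' (x + dstar) * f' (x + 2 • dstar)) := by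
    intro x
    have hli := hv x (x + dstar) (x + 2 • dstar) (by simpa using hd)
      (by intro h; exact h2d (left_eq_add.mp h))
      (by intro h; rw [two_nsmul, ← add_assoc] at h; exact hd (left_eq_add.mp h))
    have hk := key_equidist p m _ hli ![G x, G (x + dstar), G (x + 2 • dstar)]
      ![0, ∑ j, d' j * v (x + dstar) j, ∑ j, (2 • d') j * v (x + 2 • dstar) j]
    simp only [Fin.prod_univ_three, Matrix.cons_val, hG, ← Finset.sum_add_distrib, add_zero,
      ← add_mul] at hk
    have hp3 : (p : ℝ) ^ 3 ≠ 0 := pow_ne_zero _ hp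
    apply mul_left_cancel₀ hp3
    have e : ∀ y : Fin m → ZMod p,
        f (x, y) * f (x + dstar, y + d') * f (x + 2 • dstar, y + 2 • d') =
        G x (∑ j, y j * v x j) * G (x + dstar) (∑ j, (y j + d' j) * v (x + dstar) j) *
        G (x + 2 • dstar) (∑ j, (y j + (2 • d') j) * v (x + 2 • dstar) j) := by
      intro y
      rw [hf, hf, hf]
      rfl
    rw [Finset.sum_congr rfl fun y _ => e y, hk]
    ring
  simp_rw [hx, ← Finset.mul_sum]
  field_simp
end

section
/- Let p be an odd prime, n a positive integer, N = p^n, α ∈ (0, 1], and η ≥ 0 with η·(N−1) ≤ 1 and (1+η)·α ≤ 1. Define f : 𝔽_p^n → [0,1] by f(0) = (1 − η(N−1))·α and f(x) = (1+η)·α for x ≠ 0. Then: (i) the density of f is α; (ii) for every nonzero d ∈ 𝔽_p^n, the density of 3-APs with common difference d of f equals (1 − 2η)(1+η)²·α³ = (1 − 3η² − 2η³)·α³; and (iii) the density of 3-APs with common difference 0 of f equals (1 + 3η²(N−1) − η³(N−1)(N−2))·α³. -/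
/-- Level-1 construction. Let `p` be an odd prime, `n` a positive
integer, `N = p^n`, `α ∈ (0, 1]` and `η ≥ 0` with `η (N - 1) ≤ 1` and
`(1 + η) α ≤ 1`. Define `f : 𝔽_p^n → [0,1]` by `f(0) = (1 - η(N-1)) α` and
`f(x) = (1 + η) α` for `x ≠ 0`. Then: (i) the density of `f` is `α`; (ii) for every
nonzero `d`, the density of 3-APs with common difference `d` of `f` equals
`(1 - 2η)(1 + η)² α³ = (1 - 3η² - 2η³) α³`; and (iii) the density of 3-APs with
common difference `0` of `f` equals `(1 + 3η²(N-1) - η³(N-1)(N-2)) α³`. -/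
theorem level_one_construction (p : ℕ) [Fact p.Prime] (hodd : Odd p) (n : ℕ)
    (hn : 0 < n) (α η : ℝ) (hα0 : 0 < α) (hα1 : α ≤ 1) (hη : 0 ≤ η)
    (hη1 : η * ((p : ℝ) ^ n - 1) ≤ 1) (hηα : (1 + η) * α ≤ 1)
    (f : (Fin n → ZMod p) → ℝ)
    (hf : ∀ x : Fin n → ZMod p,
      f x = if x = 0 then (1 - η * ((p : ℝ) ^ n - 1)) * α else (1 + η) * α) :
    ((∑ x, f x) / (p : ℝ) ^ n = α) ∧
    (∀ d : Fin n → ZMod p, d ≠ 0 →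
      (∑ x, f x * f (x + d) * f (x + 2 • d)) / (p : ℝ) ^ n =
        (1 - 2 * η) * (1 + η) ^ 2 * α ^ 3 ∧
      (∑ x, f x * f (x + d) * f (x + 2 • d)) / (p : ℝ) ^ n =
        (1 - 3 * η ^ 2 - 2 * η ^ 3) * α ^ 3) ∧
    ((∑ x, f x * f x * f x) / (p : ℝ) ^ n =
      (1 + 3 * η ^ 2 * ((p : ℝ) ^ n - 1) -
        η ^ 3 * ((p : ℝ) ^ n - 1) * ((p : ℝ) ^ n - 2)) * α ^ 3) := by
  have hp : p.Prime := Fact.out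
  have hN : (p : ℝ) ^ n ≠ 0 := pow_ne_zero _ (by exact_mod_cast hp.ne_zero)
  have hcard : ((Fintype.card (Fin n → ZMod p) : ℕ) : ℝ) = (p : ℝ) ^ n := by
    simp [ZMod.card]
  generalize hNN : (p : ℝ) ^ n = N at *
  have hconst : ∀ c : ℝ, ∑ _x : Fin n → ZMod p, c = N * c := by
    intro c
    rw [Finset.sum_const, Finset.card_univ, nsmul_eq_mul, hcard]
  have hind : ∀ (y : Fin n → ZMod p) (c : ℝ), ∑ x, (if x = y then c else 0) = c := by
    intro y c
    simp
  refine ⟨?_, ?_, ?_⟩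
  · have h : ∀ x, f x = (1 + η) * α + (if x = 0 then -(η * N * α) else 0) := by
      intro x
      rw [hf]
      split_ifs <;> ring
    rw [Finset.sum_congr rfl (fun x _ => h x), Finset.sum_add_distrib, hconst, hind]
    field_simp
    ring
  · intro d hd
    have h2d : 2 • d ≠ 0 := by
      obtain ⟨i, hi⟩ := Function.ne_iff.mp hd
      intro h
      have h1 := congrFun h i
      simp only [Pi.smul_apply, Pi.zero_apply, nsmul_eq_mul] at h1 hi
      rcases mul_eq_zero.mp h1 with h3 | h3
      · rw [ZMod.natCast_eq_zero_iff] at h3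
        have := (Nat.prime_dvd_prime_iff_eq hp Nat.prime_two).mp h3
        subst this
        exact absurd hodd (by decide)
      · exact hi h3
    have h : ∀ x, f x * f (x + d) * f (x + 2 • d) = ((1 + η) * α) ^ 3 +
        ((if x = 0 then -(η * N * α) * ((1 + η) * α) ^ 2 else 0) +
        (if x = -d then -(η * N * α) * ((1 + η) * α) ^ 2 else 0) +
        (if x = -(2 • d) then -(η * N * α) * ((1 + η) * α) ^ 2 else 0)) := by
      intro x
      rw [hf, hf, hf]
      simp only [← eq_neg_iff_add_eq_zero]
      have e1 : ¬ (0 = -d) := fun h => hd (by simpa using h.symm)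
      have e2 : ¬ (0 = -(2 • d)) := fun h => h2d (neg_eq_zero.mp h.symm)
      have e3 : ¬ (-d = -(2 • d)) := fun h => hd (by
        have := neg_injective h
        rw [two_nsmul] at this
        simpa using this)
      by_cases h0 : x = 0
      · subst h0
        rw [if_neg e1, if_neg e2, if_neg e1, if_neg e2]
        simp only [if_true]
        ring
      · by_cases h1 : x = -d
        · subst h1
          rw [if_neg e3, if_neg h0, if_neg h0, if_neg e3]
          simp only [if_true]
          ring
        · rw [if_neg h0, if_neg h1, if_neg h0, if_neg h1]
          split_ifs <;> ring
    rw [Finset.sum_congr rfl (fun x _ => h x), Finset.sum_add_distrib, hconst,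
      Finset.sum_add_distrib, Finset.sum_add_distrib, hind, hind, hind]
    constructor
    · field_simp
      ring
    · field_simp
      ring
  · have h : ∀ x, f x * f x * f x = ((1 + η) * α) ^ 3 +
        (if x = 0 then ((1 - η * (N - 1)) * α) ^ 3 - ((1 + η) * α) ^ 3 else 0) := by
      intro x
      rw [hf]
      split_ifs <;> ring
    rw [Finset.sum_congr rfl (fun x _ => h x), Finset.sum_add_distrib, hconst, hind]
    field_simp
    ring
end
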